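/- arXiv:2212.08962 — 2 statements merged into one kernel-verified Lean document; each statement's English description precedes it below -/
import Mathlib

section
/- Let X be a topological space with π₂(X) = 0. Then every toroidal class in H₂(X; ℚ) has a π₁-injective representative; that is, if v ∈ H₂(X; ℚ) is non-zero and there exist a continuous map f : T² → X and α ∈ ℚ \ {0} with H₂(f)([T²]) = α·v, then there exist a continuous map g : T² → X and β ∈ ℚ \ {0} with H₂(g)([T²]) = β·v such that the induced homomorphism g₊ : π₁(T²) → π₁(X) is injective. -/
/-!
Common definitions: rational singular (co)homology, homotopy groups and asphericity,
classifying maps, closed oriented manifolds, connected sums, wedges, topological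
complexity, sectional category weights, and (a)toroidal classes.
-/

open CategoryTheory unitInterval Topology

noncomputable section

/-- The singular chain complex with rational coefficients. -/
def singularChainComplex : TopCat.{0} ⥤ ChainComplex (ModuleCat.{0} ℚ) ℕ :=
  TopCat.toSSet ⋙ ((SimplicialObject.whiskering _ _).obj (ModuleCat.free ℚ)) ⋙
    AlgebraicTopology.alternatingFaceMapComplex (ModuleCat ℚ)

/-- The `k`-th singular homology functor with rational coefficients. -/
def singularHomologyFunctor (k : ℕ) : TopCat.{0} ⥤ ModuleCat.{0} ℚ :=
  singularChainComplex ⋙ HomologicalComplex.homologyFunctor (ModuleCat ℚ) (ComplexShape.down ℕ) k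

/-- `H k X` is the `k`-th rational singular homology group `H_k(X; ℚ)`. -/
abbrev H (k : ℕ) (X : Type) [TopologicalSpace X] : Type :=
  (singularHomologyFunctor k).obj (TopCat.of X)

/-- The map `H_k(f; ℚ)` induced on rational singular homology by a continuous map `f`. -/
def Hmap (k : ℕ) {X Y : Type} [TopologicalSpace X] [TopologicalSpace Y] (f : C(X, Y)) :
    H k X →ₗ[ℚ] H k Y :=
  ((singularHomologyFunctor k).map (TopCat.ofHom f : TopCat.of X ⟶ TopCat.of Y)).hom

/-- `Hco k X` is the `k`-th rational singular cohomology group `H^k(X; ℚ)`; over the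
field `ℚ`, universal coefficients identify it naturally with the dual of homology. -/
abbrev Hco (k : ℕ) (X : Type) [TopologicalSpace X] : Type :=
  Module.Dual ℚ (H k X)

/-- The map `H^k(f; ℚ)` induced on rational singular cohomology (the Kronecker-dual
of the map induced on homology). -/
def Hcomap (k : ℕ) {X Y : Type} [TopologicalSpace X] [TopologicalSpace Y] (f : C(X, Y)) :
    Hco k Y →ₗ[ℚ] Hco k X :=
  (Hmap k f).dualMap

/-- Transport of a cohomology class along an equality of degrees. -/
def coCast {X : Type} [TopologicalSpace X] {p q : ℕ} (h : p = q) :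
    Hco p X →ₗ[ℚ] Hco q X := by
  subst h; exact LinearMap.id

/-- A non-zero element spanning a rational vector space (necessarily one-dimensional);
this characterises fundamental classes in the top (co)homology of closed connected
oriented manifolds with rational coefficients. -/
def IsGenerator {W : Type} [AddCommGroup W] [Module ℚ W] (w : W) : Prop :=
  w ≠ 0 ∧ ∀ v : W, ∃ c : ℚ, v = c • w

/-- `π₂(X) = 0`. -/
def Pi2Trivial (X : Type) [TopologicalSpace X] : Prop :=
  ∀ x : X, Subsingleton (HomotopyGroup (Fin 2) X x)

/-- A space is aspherical iff all its homotopy groups in degrees `≥ 2` vanish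
(for manifolds this is equivalent to contractibility of the universal cover). -/
def Aspherical (X : Type) [TopologicalSpace X] : Prop :=
  ∀ k : ℕ, 2 ≤ k → ∀ x : X, Subsingleton (HomotopyGroup (Fin k) X x)

/-- A continuous map, regarded as a morphism in `TopCat`. -/
def toTopHom {X Y : Type} [TopologicalSpace X] [TopologicalSpace Y] (f : C(X, Y)) :
    TopCat.of X ⟶ TopCat.of Y := TopCat.ofHom f

/-- The homomorphism induced by a continuous map on fundamental groups. -/
def π₁map {X Y : Type} [TopologicalSpace X] [TopologicalSpace Y] (f : C(X, Y)) (x : X) :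
    Aut (FundamentalGroupoid.mk x) →* Aut (FundamentalGroupoid.mk (f x)) :=
  Functor.mapAut (X := FundamentalGroupoid.mk x)
    (show FundamentalGroupoid X ⥤ FundamentalGroupoid Y from
      FundamentalGroupoid.fundamentalGroupoidFunctor.map (toTopHom f))

/-- `B` is a model for an Eilenberg–MacLane space `K(G, 1)`:  it is path-connected and
all its higher homotopy groups vanish. -/
def IsAsphericalSpace (B : Type) [TopologicalSpace B] : Prop :=
  PathConnectedSpace B ∧ Aspherical B

/-- `c : M → B` is a classifying map for `M`, i.e. `B` is a model for `Bπ₁(M)`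
(path-connected with vanishing higher homotopy groups) and `c` induces an isomorphism
on fundamental groups. -/
def IsClassifyingMap {M B : Type} [TopologicalSpace M] [TopologicalSpace B]
    (c : C(M, B)) : Prop :=
  IsAsphericalSpace B ∧ ∀ x : M, Function.Bijective (π₁map c x)

/-- Every point has a neighbourhood homeomorphic to `ℝⁿ`. -/
def IsLocallyEuclidean (n : ℕ) (M : Type) [TopologicalSpace M] : Prop :=
  ∀ x : M, ∃ U : Set M, x ∈ U ∧ IsOpen U ∧ Nonempty (U ≃ₜ EuclideanSpace ℝ (Fin n))

/-- A closed connected oriented topological `n`-manifold.  (For a closed connected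
`n`-manifold, orientability is equivalent to `H_n(M; ℚ) ≠ 0`.) -/
def IsClosedOrientedManifold (n : ℕ) (M : Type) [TopologicalSpace M] : Prop :=
  CompactSpace M ∧ T2Space M ∧ SecondCountableTopology M ∧ ConnectedSpace M ∧
    IsLocallyEuclidean n M ∧ Nontrivial (H n M)

/-- Data exhibiting `N` as a connected sum `M₁ # M₂` of `n`-manifolds:  `N` is covered by
two closed pieces `C₁`, `C₂`, homeomorphic to `M₁` resp. `M₂` with an embedded open ball
removed, which overlap exactly along the boundary spheres.  (Gluing along any
homeomorphism of the sphere yields a space homeomorphic to the connected sum.) -/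
structure ConnectedSumData (n : ℕ) (N M₁ M₂ : Type) [TopologicalSpace N]
    [TopologicalSpace M₁] [TopologicalSpace M₂] where
  φ₁ : EuclideanSpace ℝ (Fin n) → M₁
  φ₂ : EuclideanSpace ℝ (Fin n) → M₂
  emb₁ : IsOpenEmbedding φ₁
  emb₂ : IsOpenEmbedding φ₂
  C₁ : Set N
  C₂ : Set N
  closed₁ : IsClosed C₁
  closed₂ : IsClosed C₂
  cover : C₁ ∪ C₂ = Set.univ
  h₁ : C₁ ≃ₜ ((φ₁ '' Metric.ball 0 1)ᶜ : Set M₁)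
  h₂ : C₂ ≃ₜ ((φ₂ '' Metric.ball 0 1)ᶜ : Set M₂)
  inter₁ : ∀ x : C₁, (x : N) ∈ C₂ ↔ ((h₁ x : M₁) ∈ φ₁ '' Metric.sphere 0 1)
  inter₂ : ∀ x : C₂, (x : N) ∈ C₁ ↔ ((h₂ x : M₂) ∈ φ₂ '' Metric.sphere 0 1)

/-- `N` is a connected sum of `M₁` and `M₂` (as `n`-manifolds). -/
def IsConnectedSum (n : ℕ) (N M₁ M₂ : Type) [TopologicalSpace N]
    [TopologicalSpace M₁] [TopologicalSpace M₂] : Prop :=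
  Nonempty (ConnectedSumData n N M₁ M₂)

/-- The degree-one pinch map `N = M₁ # M₂ → M₁`:  it restricts to the canonical
identification on the `M₁`-piece and sends the `M₂`-piece into the closed ball. -/
def ConnectedSumData.IsPinchFst {n : ℕ} {N M₁ M₂ : Type} [TopologicalSpace N]
    [TopologicalSpace M₁] [TopologicalSpace M₂] (D : ConnectedSumData n N M₁ M₂)
    (p : C(N, M₁)) : Prop :=
  (∀ x : D.C₁, p (x : N) = (D.h₁ x : M₁)) ∧
    ∀ x : D.C₂, p (x : N) ∈ D.φ₁ '' Metric.closedBall 0 1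

/-- The degree-one pinch map `N = M₁ # M₂ → M₂`. -/
def ConnectedSumData.IsPinchSnd {n : ℕ} {N M₁ M₂ : Type} [TopologicalSpace N]
    [TopologicalSpace M₁] [TopologicalSpace M₂] (D : ConnectedSumData n N M₁ M₂)
    (p : C(N, M₂)) : Prop :=
  (∀ x : D.C₂, p (x : N) = (D.h₂ x : M₂)) ∧
    ∀ x : D.C₁, p (x : N) ∈ D.φ₂ '' Metric.closedBall 0 1

/-- `N` is an iterated connected sum `M 0 # M 1 # ⋯ # M (m-1)` of `n`-manifolds. -/
def IsIteratedConnectedSum (n : ℕ) (N : Type) [TopologicalSpace N] :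
    (m : ℕ) → (Fin m → TopCat.{0}) → Prop
  | 0, _ => False
  | 1, M => Nonempty (N ≃ₜ (M 0))
  | (m + 2), M =>
      ∃ P : TopCat.{0}, IsIteratedConnectedSum n P (m + 1) (fun i => M i.castSucc) ∧
        IsConnectedSum n N P (M (Fin.last (m + 1)))

/-- `W` is the wedge (one-point union) of the pointed spaces `(M₁, x₁)` and `(M₂, x₂)`. -/
def IsWedge (W M₁ M₂ : Type) [TopologicalSpace W] [TopologicalSpace M₁]
    [TopologicalSpace M₂] (x₁ : M₁) (x₂ : M₂) : Prop :=
  ∃ (j₁ : C(M₁, W)) (j₂ : C(M₂, W)), IsClosedEmbedding j₁ ∧ IsClosedEmbedding j₂ ∧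
    Set.range j₁ ∪ Set.range j₂ = Set.univ ∧
    Set.range j₁ ∩ Set.range j₂ = {j₁ x₁} ∧ j₁ x₁ = j₂ x₂

/-- `X × X` admits a cover by `m` open sets over each of which there is a continuous
motion planning rule (a continuous local section of the free path fibration). -/
def TCCoverable (X : Type) [TopologicalSpace X] (m : ℕ) : Prop :=
  ∃ U : Fin m → Set (X × X), (∀ i, IsOpen (U i)) ∧ (⋃ i, U i) = Set.univ ∧
    ∀ i, ∃ s : C(U i, C(I, X)),
      ∀ p : U i, (s p) 0 = (p : X × X).1 ∧ (s p) 1 = (p : X × X).2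

/-- The (unreduced) topological complexity of `X`:  the smallest number of open sets in a
cover of `X × X` admitting continuous motion planning rules (`⊤` if there is none). -/
def topologicalComplexity (X : Type) [TopologicalSpace X] : ℕ∞ :=
  sInf {c : ℕ∞ | ∃ m : ℕ, c = m ∧ TCCoverable X m}

/-- The free path fibration `X^{[0,1]} → X × X`, `γ ↦ (γ(0), γ(1))`. -/
def pathFibration (X : Type) [TopologicalSpace X] : C(C(I, X), X × X) :=
  ⟨fun γ => (γ 0, γ 1), (continuous_eval_const 0).prodMk (continuous_eval_const 1)⟩

/-- The Schwarz genus (sectional category) of the pullback of `p` along `f` is at most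
`k`:  `Y` is covered by `k` open sets over each of which `f` lifts continuously
through `p`. -/
def GenusPullbackLE {E B : Type} [TopologicalSpace E] [TopologicalSpace B] (p : C(E, B))
    {Y : Type} [TopologicalSpace Y] (f : C(Y, B)) (k : ℕ) : Prop :=
  ∃ U : Fin k → Set Y, (∀ i, IsOpen (U i)) ∧ (⋃ i, U i) = Set.univ ∧
    ∀ i, ∃ s : C(U i, E), ∀ y : U i, p (s y) = f (y : Y)

/-- The sectional category weight of a cohomology class `u` on the base of `p`:  the
supremum of those `m` such that `u` pulls back to zero along every map `f` for which
the pullback of `p` along `f` has Schwarz genus at most `m`. -/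
def secatWeight {E B : Type} [TopologicalSpace E] [TopologicalSpace B] (p : C(E, B))
    {k : ℕ} (u : Hco k B) : ℕ∞ :=
  sSup {w : ℕ∞ | ∃ m : ℕ, w = m ∧ ∀ (Y : Type) [TopologicalSpace Y] (f : C(Y, B)),
    GenusPullbackLE p f m → Hcomap k f u = 0}

/-- The topological complexity weight:  sectional category weight with respect to the
free path fibration. -/
def tcWeight {X : Type} [TopologicalSpace X] {k : ℕ} (u : Hco k (X × X)) : ℕ∞ :=
  secatWeight (pathFibration X) u

/-- The `n`-dimensional sphere. -/
abbrev unitSphere (n : ℕ) : Type :=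
  ↥(Metric.sphere (0 : EuclideanSpace ℝ (Fin (n + 1))) 1)

/-- The 2-torus `T² = S¹ × S¹`. -/
abbrev Torus2 : Type := unitSphere 1 × unitSphere 1

/-- A degree-two rational homology class `v` is toroidal (relative to a fundamental class
`ωT` of the torus) if some map from the torus realises a non-zero multiple of `v`. -/
def IsToroidal {X : Type} [TopologicalSpace X] (ωT : H 2 Torus2) (v : H 2 X) : Prop :=
  ∃ (f : C(Torus2, X)) (α : ℚ), α ≠ 0 ∧ Hmap 2 f ωT = α • v

/-- A non-zero degree-two rational homology class is atoroidal if it is not toroidal. -/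
def IsAtoroidal {X : Type} [TopologicalSpace X] (ωT : H 2 Torus2) (v : H 2 X) : Prop :=
  v ≠ 0 ∧ ¬ IsToroidal ωT v

/-- A degree-two rational cohomology class `u` is toroidal if it pulls back non-trivially
under some map from the torus. -/
def IsCoToroidal {X : Type} [TopologicalSpace X] (u : Hco 2 X) : Prop :=
  ∃ f : C(Torus2, X), Hcomap 2 f u ≠ 0

/-- A non-zero degree-two rational cohomology class is atoroidal if it pulls back to zero
under every map from the torus. -/
def IsCoAtoroidal {X : Type} [TopologicalSpace X] (u : Hco 2 X) : Prop :=
  u ≠ 0 ∧ ∀ f : C(Torus2, X), Hcomap 2 f u = 0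

section singularChains
open Opposite Simplicial

/-- The module of rational singular `n`-chains of `X`. -/
abbrev SingularChain (n : ℕ) (X : Type) [TopologicalSpace X] : Type :=
  (singularChainComplex.obj (TopCat.of X)).X n

/-- The boundary operator on rational singular chains. -/
def chainBoundary (n : ℕ) (X : Type) [TopologicalSpace X] :
    SingularChain (n + 1) X →ₗ[ℚ] SingularChain n X :=
  ((singularChainComplex.obj (TopCat.of X)).d (n + 1) n).hom

/-- The map induced by a continuous map on rational singular chains. -/
def chainMap (n : ℕ) {X Y : Type} [TopologicalSpace X] [TopologicalSpace Y] (f : C(X, Y)) :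
    SingularChain n X →ₗ[ℚ] SingularChain n Y :=
  ((singularChainComplex.map (TopCat.ofHom f : TopCat.of X ⟶ TopCat.of Y)).f n).hom

/-- The chain of a single singular simplex. -/
def simplexChain {n : ℕ} {X : Type} [TopologicalSpace X]
    (τ : C(stdSimplex ℝ (Fin (n + 1)), X)) : SingularChain n X :=
  ModuleCat.freeMk (R := ℚ) ((TopCat.toSSetObjEquiv (TopCat.of X) (op ⦋n⦌)).symm τ)

/-- The inclusion of the `i`-th face of the standard simplex. -/
def simplexFace {n : ℕ} (i : Fin (n + 2)) :
    C(stdSimplex ℝ (Fin (n + 1)), stdSimplex ℝ (Fin (n + 2))) :=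
  ⟨stdSimplex.map i.succAbove, stdSimplex.continuous_map _⟩

section chains
variable {X Y : Type} [TopologicalSpace X] [TopologicalSpace Y]

theorem chainMap_simplexChain {n : ℕ} (f : C(X, Y)) (τ : C(stdSimplex ℝ (Fin (n + 1)), X)) :
    chainMap n f (simplexChain τ) = simplexChain (f.comp τ) :=
  ModuleCat.free_map_apply (R := ℚ) _ _

theorem chainBoundary_simplexChain {n : ℕ} (τ : C(stdSimplex ℝ (Fin (n + 2)), X)) :
    chainBoundary n X (simplexChain τ) =
      ∑ i : Fin (n + 2), (-1 : ℤ) ^ (i : ℕ) • simplexChain (τ.comp (simplexFace i)) := by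
  have h : (singularChainComplex.obj (TopCat.of X)).d (n + 1) n =
      ∑ i : Fin (n + 2), (-1 : ℤ) ^ (i : ℕ) •
        (((SimplicialObject.whiskering _ _).obj (ModuleCat.free ℚ)).obj
          (TopCat.toSSet.obj (TopCat.of X))).δ i :=
    AlgebraicTopology.AlternatingFaceMapComplex.obj_d_eq _ _
  refine (congrArg (fun m => m.hom (simplexChain τ)) h).trans ?_
  refine (LinearMap.congr_fun (ModuleCat.hom_sum _ _) _).trans ?_
  refine (LinearMap.sum_apply _ _ _).trans (Finset.sum_congr rfl fun i _ => ?_)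
  exact congrArg ((-1 : ℤ) ^ (i : ℕ) • ·) (ModuleCat.free_map_apply (R := ℚ) _ _)

/-- A linear functional on chains, given by its values on simplices. -/
def chainFunctional {n : ℕ} (φ : C(stdSimplex ℝ (Fin (n + 1)), X) → ℝ) :
    SingularChain n X →ₗ[ℚ] ℝ :=
  Finsupp.lift ℝ ℚ _ fun s => φ (TopCat.toSSetObjEquiv (TopCat.of X) (op ⦋n⦌) s)

theorem chainFunctional_simplexChain {n : ℕ} (φ : C(stdSimplex ℝ (Fin (n + 1)), X) → ℝ)
    (τ : C(stdSimplex ℝ (Fin (n + 1)), X)) :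
    chainFunctional φ (simplexChain τ) = φ τ := by
  unfold chainFunctional simplexChain ModuleCat.freeMk
  erw [Finsupp.lift_apply, Finsupp.sum_single_index] <;> simp

theorem chain_hom_ext {n : ℕ} {M : Type} [AddCommGroup M] [Module ℚ M]
    {φ ψ : SingularChain n X →ₗ[ℚ] M}
    (h : ∀ τ, φ (simplexChain τ) = ψ (simplexChain τ)) : φ = ψ := by
  refine Finsupp.lhom_ext' fun s => LinearMap.ext_ring ?_
  have := h (TopCat.toSSetObjEquiv (TopCat.of X) (op ⦋n⦌) s)
  unfold simplexChain at this
  rw [Equiv.symm_apply_apply] at this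
  exact this

/-- A morphism of chain complexes kills a generator of the second homology as soon as it sends to
a boundary some `2`-cycle on which some `2`-cocycle does not vanish. -/
theorem homologyMap_eq_zero_of_cycle {K L : ChainComplex (ModuleCat.{0} ℚ) ℕ} (F : K ⟶ L)
    (ω : K.homology 2) (hω : IsGenerator ω) {M : ModuleCat.{0} ℚ} (φ : K.X 2 ⟶ M)
    (hφ : K.d 3 2 ≫ φ = 0) (z : K.X 2) (hz : K.d 2 1 z = 0) (hφz : φ z ≠ 0)
    (w : L.X 3) (hw : L.d 3 2 w = F.f 2 z) :
    HomologicalComplex.homologyMap F 2 ω = 0 := by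
  obtain ⟨ζ, hζ⟩ : ∃ ζ : K.cycles 2, K.iCycles 2 ζ = z :=
    ⟨_, HomologicalComplex.i_cyclesMk K z 1 (ChainComplex.next_nat_succ 1) hz⟩
  obtain ⟨c, hc⟩ := hω.2 (K.homologyπ 2 ζ)
  have hval : (K.homologyι 2 ≫ K.descOpcycles φ 3 (ChainComplex.prev ℕ 2) hφ)
      (K.homologyπ 2 ζ) = φ z := by
    rw [← ConcreteCategory.comp_apply, HomologicalComplex.homology_π_ι_assoc,
      HomologicalComplex.p_descOpcycles, ConcreteCategory.comp_apply, hζ]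
  have hc0 : c ≠ 0 := by
    rintro rfl
    rw [zero_smul] at hc
    rw [hc, map_zero] at hval
    exact hφz hval.symm
  have hzero : HomologicalComplex.homologyMap F 2 (K.homologyπ 2 ζ) = 0 := by
    have hcyc : HomologicalComplex.cyclesMap F 2 ζ = L.toCycles 3 2 w := by
      have hmono : Function.Injective (L.iCycles 2) :=
        (ModuleCat.mono_iff_injective _).1 inferInstance
      apply hmono
      rw [← ConcreteCategory.comp_apply, ← ConcreteCategory.comp_apply,
        HomologicalComplex.cyclesMap_i, HomologicalComplex.toCycles_i,
        ConcreteCategory.comp_apply, hζ, hw]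
    rw [← ConcreteCategory.comp_apply, HomologicalComplex.homologyπ_naturality,
      ConcreteCategory.comp_apply, hcyc, ← ConcreteCategory.comp_apply,
      HomologicalComplex.toCycles_comp_homologyπ]
    rfl
  rw [hc, map_smul] at hzero
  exact (smul_eq_zero.1 hzero).resolve_left hc0

/-- If `H₂(X)` is generated by `ω`, a continuous map `f` kills `ω` as soon as it sends to a boundary
some `2`-cycle on which some `2`-cocycle does not vanish. -/
theorem Hmap_eq_zero_of_cycle (f : C(X, Y)) (ω : H 2 X) (hω : IsGenerator ω)
    (φ : SingularChain 2 X →ₗ[ℚ] ℝ) (hφ : φ ∘ₗ chainBoundary 2 X = 0)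
    (z : SingularChain 2 X) (hz : chainBoundary 1 X z = 0) (hφz : φ z ≠ 0)
    (hfz : chainMap 2 f z ∈ LinearMap.range (chainBoundary 2 Y)) : Hmap 2 f ω = 0 := by
  obtain ⟨w, hw⟩ := hfz
  exact homologyMap_eq_zero_of_cycle
    (singularChainComplex.map (TopCat.ofHom f : TopCat.of X ⟶ TopCat.of Y)) ω hω
    (ModuleCat.ofHom φ) (ModuleCat.hom_ext hφ) z hz hφz w hw

end chains

end singularChains

section affine
variable {V W : Type} [AddCommGroup V] [Module ℝ V] [TopologicalSpace V] [ContinuousAdd V]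
  [ContinuousSMul ℝ V] [AddCommGroup W] [Module ℝ W] [TopologicalSpace W] [ContinuousAdd W]
  [ContinuousSMul ℝ W] {X Y : Type} [TopologicalSpace X] [TopologicalSpace Y]

/-- The affine simplex with vertices `w`. -/
def affineSimplex {n : ℕ} (w : Fin n → V) : C(stdSimplex ℝ (Fin n), V) where
  toFun x := ∑ i, x i • w i
  continuous_toFun := by
    refine continuous_finsetSum _ fun i _ => Continuous.smul ?_ continuous_const
    exact (continuous_apply i).comp continuous_subtype_val

theorem affineSimplex_apply {n : ℕ} (w : Fin n → V) (x : stdSimplex ℝ (Fin n)) :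
    affineSimplex w x = ∑ i, x i • w i := rfl

theorem affineSimplex_comp_simplexFace {n : ℕ} (w : Fin (n + 2) → V) (i : Fin (n + 2)) :
    (affineSimplex w).comp (simplexFace i) = affineSimplex (w ∘ i.succAbove) := by
  ext x
  simp only [ContinuousMap.comp_apply, affineSimplex_apply, simplexFace, ContinuousMap.coe_mk,
    Function.comp_apply]
  simp only [stdSimplex.map_coe, FunOnFinite.linearMap_apply_apply, Finset.sum_smul]
  rw [← Finset.sum_fiberwise Finset.univ i.succAbove fun j => x j • w (i.succAbove j)]
  refine Finset.sum_congr rfl fun k _ => Finset.sum_congr rfl fun j hj => ?_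
  rw [(Finset.mem_filter.1 hj).2]

/-- The singular simplex obtained by restricting `G` to an affine simplex. -/
def affineChain {n : ℕ} (G : C(V, X)) (w : Fin (n + 1) → V) : SingularChain n X :=
  simplexChain (G.comp (affineSimplex w))

theorem chainBoundary_affineChain {n : ℕ} (G : C(V, X)) (w : Fin (n + 2) → V) :
    chainBoundary n X (affineChain G w) =
      ∑ i : Fin (n + 2), (-1 : ℤ) ^ (i : ℕ) • affineChain G (w ∘ i.succAbove) := by
  simp only [affineChain, chainBoundary_simplexChain, ContinuousMap.comp_assoc,
    affineSimplex_comp_simplexFace]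

theorem chainBoundary_triangle (G : C(V, X)) (a b c : V) :
    chainBoundary 1 X (affineChain G ![a, b, c]) =
      affineChain G ![b, c] - affineChain G ![a, c] + affineChain G ![a, b] := by
  have h0 : ![a, b, c] ∘ (0 : Fin 3).succAbove = ![b, c] := by ext i; fin_cases i <;> rfl
  have h1 : ![a, b, c] ∘ (1 : Fin 3).succAbove = ![a, c] := by ext i; fin_cases i <;> rfl
  have h2 : ![a, b, c] ∘ (2 : Fin 3).succAbove = ![a, b] := by ext i; fin_cases i <;> rfl
  rw [chainBoundary_affineChain, Fin.sum_univ_three, h0, h1, h2]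
  simp [sub_eq_add_neg]

theorem chainBoundary_tetrahedron (G : C(V, X)) (a b c d : V) :
    chainBoundary 2 X (affineChain G ![a, b, c, d]) =
      affineChain G ![b, c, d] - affineChain G ![a, c, d] + affineChain G ![a, b, d] -
        affineChain G ![a, b, c] := by
  have h0 : ![a, b, c, d] ∘ (0 : Fin 4).succAbove = ![b, c, d] := by ext i; fin_cases i <;> rfl
  have h1 : ![a, b, c, d] ∘ (1 : Fin 4).succAbove = ![a, c, d] := by ext i; fin_cases i <;> rfl
  have h2 : ![a, b, c, d] ∘ (2 : Fin 4).succAbove = ![a, b, d] := by ext i; fin_cases i <;> rfl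
  have h3 : ![a, b, c, d] ∘ (3 : Fin 4).succAbove = ![a, b, c] := by ext i; fin_cases i <;> rfl
  rw [chainBoundary_affineChain, Fin.sum_univ_four, h0, h1, h2, h3]
  simp [sub_eq_add_neg, pow_succ]

theorem affineChain_congr {n : ℕ} {G : C(V, X)} {G' : C(W, X)} {w : Fin (n + 1) → V}
    {w' : Fin (n + 1) → W} (h : ∀ x, G (affineSimplex w x) = G' (affineSimplex w' x)) :
    affineChain G w = affineChain G' w' :=
  congrArg simplexChain (ContinuousMap.ext h)

theorem affineChain_triangle_congr {G : C(V, X)} {G' : C(W, X)} {a b c : V} {a' b' c' : W}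
    (h : ∀ x y : ℝ, 0 ≤ x → 0 ≤ y → x + y ≤ 1 →
      G ((1 - x - y) • a + x • b + y • c) = G' ((1 - x - y) • a' + x • b' + y • c')) :
    affineChain G ![a, b, c] = affineChain G' ![a', b', c'] := by
  refine affineChain_congr fun (x : stdSimplex ℝ (Fin 3)) => ?_
  have hsum := x.2.2
  rw [Fin.sum_univ_three] at hsum
  have h0 : x.1 0 = 1 - x.1 1 - x.1 2 := by linarith
  have hV : affineSimplex ![a, b, c] x = x.1 0 • a + x.1 1 • b + x.1 2 • c :=
    Fin.sum_univ_three fun i => x.1 i • ![a, b, c] i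
  have hW : affineSimplex ![a', b', c'] x = x.1 0 • a' + x.1 1 • b' + x.1 2 • c' :=
    Fin.sum_univ_three fun i => x.1 i • ![a', b', c'] i
  rw [h0] at hV hW
  refine (congrArg G hV).trans ((h _ _ (x.2.1 1) (x.2.1 2) ?_).trans (congrArg G' hW).symm)
  linarith [x.2.1 0]

theorem affineChain_edge_congr {G : C(V, X)} {G' : C(W, X)} {a b : V} {a' b' : W}
    (h : ∀ x ∈ Set.Icc (0 : ℝ) 1, G ((1 - x) • a + x • b) = G' ((1 - x) • a' + x • b')) :
    affineChain G ![a, b] = affineChain G' ![a', b'] := by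
  refine affineChain_congr fun (x : stdSimplex ℝ (Fin 2)) => ?_
  have hsum := x.2.2
  rw [Fin.sum_univ_two] at hsum
  have h0 : x.1 0 = 1 - x.1 1 := by linarith
  have hV : affineSimplex ![a, b] x = x.1 0 • a + x.1 1 • b :=
    Fin.sum_univ_two fun i => x.1 i • ![a, b] i
  have hW : affineSimplex ![a', b'] x = x.1 0 • a' + x.1 1 • b' :=
    Fin.sum_univ_two fun i => x.1 i • ![a', b'] i
  rw [h0] at hV hW
  refine (congrArg G hV).trans ((h _ ⟨x.2.1 1, ?_⟩).trans (congrArg G' hW).symm)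
  linarith [x.2.1 0]

end affine

section squares
variable {X Y : Type} [TopologicalSpace X] [TopologicalSpace Y]

/-- The chain of the unit square in `ℝ × ℝ`, mapped by `G`. -/
def squareChain (G : C(ℝ × ℝ, X)) : SingularChain 2 X :=
  affineChain G ![(0, 0), (1, 0), (1, 1)] - affineChain G ![(0, 0), (0, 1), (1, 1)]

theorem chainMap_squareChain (f : C(X, Y)) (G : C(ℝ × ℝ, X)) :
    chainMap 2 f (squareChain G) = squareChain (f.comp G) := by
  simp only [squareChain, affineChain, map_sub, chainMap_simplexChain, ContinuousMap.comp_assoc]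

theorem squareChain_congr {G G' : C(ℝ × ℝ, X)}
    (h : ∀ s ∈ Set.Icc (0 : ℝ) 1, ∀ t ∈ Set.Icc (0 : ℝ) 1, G (s, t) = G' (s, t)) :
    squareChain G = squareChain G' := by
  unfold squareChain
  congr 1 <;>
  · refine affineChain_triangle_congr fun x y hx hy hxy => ?_
    simp only [Prod.smul_mk, smul_eq_mul, Prod.mk_add_mk]
    refine h _ ⟨?_, ?_⟩ _ ⟨?_, ?_⟩ <;> linarith

theorem chainBoundary_squareChain {G : C(ℝ × ℝ, X)}
    (hs : ∀ t ∈ Set.Icc (0 : ℝ) 1, G (0, t) = G (1, t))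
    (ht : ∀ s ∈ Set.Icc (0 : ℝ) 1, G (s, 0) = G (s, 1)) :
    chainBoundary 1 X (squareChain G) = 0 := by
  have h1 : affineChain G ![(0, 0), (0, 1)] = affineChain G ![(1, 0), (1, 1)] := by
    refine affineChain_edge_congr fun x hx => ?_
    simpa using hs x hx
  have h2 : affineChain G ![(0, 0), (1, 0)] = affineChain G ![(0, 1), (1, 1)] := by
    refine affineChain_edge_congr fun x hx => ?_
    simpa using ht x hx
  rw [squareChain, map_sub, chainBoundary_triangle, chainBoundary_triangle, h1, h2]
  abel

/-- A square which only depends on its second coordinate, through a loop, is a boundary. -/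
theorem squareChain_degenerate_mem_range (γ : C(ℝ, X)) (h : γ 0 = γ 1) :
    squareChain (γ.comp ⟨Prod.snd, continuous_snd⟩) ∈ LinearMap.range (chainBoundary 2 X) := by
  have h1 : affineChain (γ.comp ⟨Prod.snd, continuous_snd⟩) ![((0 : ℝ), (0 : ℝ)), (1, 0), (1, 1)] =
      affineChain γ ![0, 0, 1] :=
    affineChain_triangle_congr fun x y _ _ _ => by simp
  have h2 : affineChain (γ.comp ⟨Prod.snd, continuous_snd⟩) ![((0 : ℝ), (0 : ℝ)), (0, 1), (1, 1)] =
      affineChain γ ![0, 1, 1] :=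
    affineChain_triangle_congr fun x y _ _ _ => by simp
  have h3 : affineChain γ ![0, 0, 0] = affineChain γ ![1, 1, 1] := by
    refine affineChain_triangle_congr fun x y _ _ _ => ?_
    have e : (1 - x - y) • (1 : ℝ) + x • 1 + y • 1 = 1 := by
      simp only [smul_eq_mul]
      ring
    rw [e]
    simpa using h
  refine ⟨affineChain γ ![0, 0, 0, 1] + affineChain γ ![0, 1, 1, 1], ?_⟩
  rw [map_add, chainBoundary_tetrahedron, chainBoundary_tetrahedron, squareChain, h1, h2, h3]
  abel

/-- The face of a cube where the first coordinate is `c`. -/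
def cubeFaceFst (C : C(ℝ × ℝ × ℝ, X)) (c : ℝ) : C(ℝ × ℝ, X) :=
  ⟨fun p => C (c, p.1, p.2), by fun_prop⟩

/-- The face of a cube where the second coordinate is `c`. -/
def cubeFaceSnd (C : C(ℝ × ℝ × ℝ, X)) (c : ℝ) : C(ℝ × ℝ, X) :=
  ⟨fun p => C (p.1, c, p.2), by fun_prop⟩

/-- The face of a cube where the third coordinate is `c`. -/
def cubeFaceThd (C : C(ℝ × ℝ × ℝ, X)) (c : ℝ) : C(ℝ × ℝ, X) :=
  ⟨fun p => C (p.1, p.2, c), by fun_prop⟩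

theorem affineChain_cubeFaceFst (C : C(ℝ × ℝ × ℝ, X)) (r : ℝ) (a b c : ℝ × ℝ) :
    affineChain (cubeFaceFst C r) ![a, b, c] = affineChain C ![(r, a), (r, b), (r, c)] := by
  refine affineChain_triangle_congr fun x y _ _ _ => ?_
  simp only [cubeFaceFst, ContinuousMap.coe_mk]
  congr 1
  ext <;> simp
  ring

theorem affineChain_cubeFaceSnd (C : C(ℝ × ℝ × ℝ, X)) (r : ℝ) (a b c : ℝ × ℝ) :
    affineChain (cubeFaceSnd C r) ![a, b, c] =
      affineChain C ![(a.1, r, a.2), (b.1, r, b.2), (c.1, r, c.2)] := by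
  refine affineChain_triangle_congr fun x y _ _ _ => ?_
  simp only [cubeFaceSnd, ContinuousMap.coe_mk]
  congr 1
  ext <;> simp
  ring

theorem affineChain_cubeFaceThd (C : C(ℝ × ℝ × ℝ, X)) (r : ℝ) (a b c : ℝ × ℝ) :
    affineChain (cubeFaceThd C r) ![a, b, c] =
      affineChain C ![(a.1, a.2, r), (b.1, b.2, r), (c.1, c.2, r)] := by
  refine affineChain_triangle_congr fun x y _ _ _ => ?_
  simp only [cubeFaceThd, ContinuousMap.coe_mk]
  congr 1
  ext <;> simp
  ring

/-- The alternating sum of the faces of a cube is a boundary. -/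
theorem cube_faces_mem_range (C : C(ℝ × ℝ × ℝ, X)) :
    squareChain (cubeFaceThd C 1) - squareChain (cubeFaceThd C 0) -
      (squareChain (cubeFaceSnd C 1) - squareChain (cubeFaceSnd C 0)) +
      (squareChain (cubeFaceFst C 1) - squareChain (cubeFaceFst C 0)) ∈
        LinearMap.range (chainBoundary 2 X) := by
  refine ⟨affineChain C ![(0, 0, 0), (1, 0, 0), (1, 1, 0), (1, 1, 1)] -
    affineChain C ![(0, 0, 0), (1, 0, 0), (1, 0, 1), (1, 1, 1)] +
    affineChain C ![(0, 0, 0), (0, 1, 0), (0, 1, 1), (1, 1, 1)] -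
    affineChain C ![(0, 0, 0), (0, 1, 0), (1, 1, 0), (1, 1, 1)] +
    affineChain C ![(0, 0, 0), (0, 0, 1), (1, 0, 1), (1, 1, 1)] -
    affineChain C ![(0, 0, 0), (0, 0, 1), (0, 1, 1), (1, 1, 1)], ?_⟩
  simp only [map_add, map_sub, chainBoundary_tetrahedron, squareChain, affineChain_cubeFaceFst,
    affineChain_cubeFaceSnd, affineChain_cubeFaceThd]
  abel

/-- Two cubes with the same lateral faces have homologous differences of top and bottom. -/
theorem cube_compare {C C' : C(ℝ × ℝ × ℝ, X)}
    (h₁ : ∀ c ∈ ({0, 1} : Set ℝ), ∀ t ∈ Set.Icc (0 : ℝ) 1, ∀ u ∈ Set.Icc (0 : ℝ) 1,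
      C (c, t, u) = C' (c, t, u))
    (h₂ : ∀ c ∈ ({0, 1} : Set ℝ), ∀ s ∈ Set.Icc (0 : ℝ) 1, ∀ u ∈ Set.Icc (0 : ℝ) 1,
      C (s, c, u) = C' (s, c, u)) :
    squareChain (cubeFaceThd C 1) - squareChain (cubeFaceThd C 0) -
      (squareChain (cubeFaceThd C' 1) - squareChain (cubeFaceThd C' 0)) ∈
        LinearMap.range (chainBoundary 2 X) := by
  have e₁ : ∀ c ∈ ({0, 1} : Set ℝ),
      squareChain (cubeFaceFst C c) = squareChain (cubeFaceFst C' c) := fun c hc =>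
    squareChain_congr fun t ht u hu => h₁ c hc t ht u hu
  have e₂ : ∀ c ∈ ({0, 1} : Set ℝ),
      squareChain (cubeFaceSnd C c) = squareChain (cubeFaceSnd C' c) := fun c hc =>
    squareChain_congr fun s hs u hu => h₂ c hc s hs u hu
  have h := Submodule.sub_mem _ (cube_faces_mem_range C) (cube_faces_mem_range C')
  rw [e₁ 0 (by simp), e₁ 1 (by simp), e₂ 0 (by simp), e₂ 1 (by simp)] at h
  convert h using 1
  abel

/-- If opposite lateral faces of a cube agree, its top and bottom are homologous. -/
theorem cube_top_sub_bottom {C : C(ℝ × ℝ × ℝ, X)}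
    (h₁ : ∀ t ∈ Set.Icc (0 : ℝ) 1, ∀ u ∈ Set.Icc (0 : ℝ) 1, C (0, t, u) = C (1, t, u))
    (h₂ : ∀ s ∈ Set.Icc (0 : ℝ) 1, ∀ u ∈ Set.Icc (0 : ℝ) 1, C (s, 0, u) = C (s, 1, u)) :
    squareChain (cubeFaceThd C 1) - squareChain (cubeFaceThd C 0) ∈
        LinearMap.range (chainBoundary 2 X) := by
  have e₁ : squareChain (cubeFaceFst C 0) = squareChain (cubeFaceFst C 1) :=
    squareChain_congr fun t ht u hu => h₁ t ht u hu
  have e₂ : squareChain (cubeFaceSnd C 0) = squareChain (cubeFaceSnd C 1) :=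
    squareChain_congr fun s hs u hu => h₂ s hs u hu
  have h := cube_faces_mem_range C
  rw [e₁, e₂] at h
  convert h using 1
  abel

end squares

section secondHomotopy
variable {X : Type} [TopologicalSpace X]

/-- In a space with trivial `π₂`, two squares with boundary mapped to the same point are
homologous. -/
theorem squareChain_sub_mem_range_of_boundary_const (hX : Pi2Trivial X) {L L' : C(ℝ × ℝ, X)}
    {x₀ : X}
    (h₁ : ∀ c ∈ ({0, 1} : Set ℝ), ∀ t ∈ Set.Icc (0 : ℝ) 1, L (c, t) = x₀ ∧ L' (c, t) = x₀)
    (h₂ : ∀ c ∈ ({0, 1} : Set ℝ), ∀ s ∈ Set.Icc (0 : ℝ) 1, L (s, c) = x₀ ∧ L' (s, c) = x₀) :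
    squareChain L - squareChain L' ∈ LinearMap.range (chainBoundary 2 X) := by
  have hb : ∀ y ∈ Cube.boundary (Fin 2), L (y 0, y 1) = x₀ ∧ L' (y 0, y 1) = x₀ := by
    rintro y ⟨i, hi⟩
    have hi' : (y i : ℝ) ∈ ({0, 1} : Set ℝ) := by
      rcases hi with hi | hi <;> simp [hi]
    fin_cases i
    · exact h₁ _ hi' _ (y 1).2
    · exact h₂ _ hi' _ (y 0).2
  let ℓ : GenLoop (Fin 2) X x₀ :=
    ⟨⟨fun y => L (y 0, y 1), by fun_prop⟩, fun y hy => (hb y hy).1⟩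
  let ℓ' : GenLoop (Fin 2) X x₀ :=
    ⟨⟨fun y => L' (y 0, y 1), by fun_prop⟩, fun y hy => (hb y hy).2⟩
  have hℓ : GenLoop.Homotopic ℓ' ℓ :=
    Quotient.exact ((hX x₀).elim (Quotient.mk _ ℓ') (Quotient.mk _ ℓ))
  obtain ⟨K⟩ := hℓ
  let C : C(ℝ × ℝ × ℝ, X) :=
    ⟨fun q => K (Set.projIcc 0 1 zero_le_one q.2.2,
      ![Set.projIcc 0 1 zero_le_one q.1, Set.projIcc 0 1 zero_le_one q.2.1]), by
      refine K.continuous.comp (Continuous.prodMk (by fun_prop) ?_)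
      refine continuous_pi fun i => ?_
      fin_cases i
      · exact (continuous_projIcc (h := zero_le_one)).comp continuous_fst
      · exact (continuous_projIcc (h := zero_le_one)).comp (continuous_fst.comp continuous_snd)⟩
  have hside : ∀ (u : I) (y : Fin 2 → I), y ∈ Cube.boundary (Fin 2) → K (u, y) = x₀ :=
    fun u y hy => (K.eq_fst u hy).trans (hb y hy).2
  have hC := cube_top_sub_bottom (C := C)
    (fun t _ u _ => (hside _ _ ⟨0, Or.inl (by simp)⟩).trans
      (hside _ _ ⟨0, Or.inr (by simp)⟩).symm)
    (fun t _ u _ => (hside _ _ ⟨1, Or.inl (by simp)⟩).trans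
      (hside _ _ ⟨1, Or.inr (by simp)⟩).symm)
  have e1 : squareChain (cubeFaceThd C 1) = squareChain L := by
    refine squareChain_congr fun s hs t ht => ?_
    change K (Set.projIcc 0 1 zero_le_one 1, ![Set.projIcc 0 1 zero_le_one s,
      Set.projIcc 0 1 zero_le_one t]) = _
    rw [Set.projIcc_right, Set.projIcc_of_mem _ hs, Set.projIcc_of_mem _ ht]
    exact K.apply_one _
  have e0 : squareChain (cubeFaceThd C 0) = squareChain L' := by
    refine squareChain_congr fun s hs t ht => ?_
    change K (Set.projIcc 0 1 zero_le_one 0, ![Set.projIcc 0 1 zero_le_one s,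
      Set.projIcc 0 1 zero_le_one t]) = _
    rw [Set.projIcc_left, Set.projIcc_of_mem _ hs, Set.projIcc_of_mem _ ht]
    exact K.apply_zero _
  rwa [e1, e0] at hC

/-- The signed sup-distance to the boundary of the unit square. -/
def squareDist (p : ℝ × ℝ) : ℝ := max (max (-p.1) (p.1 - 1)) (max (-p.2) (p.2 - 1))

@[fun_prop]
theorem continuous_squareDist : Continuous squareDist := by unfold squareDist; fun_prop

/-- The retraction of the plane to the unit square which collapses a collar of width `1` onto the
cone from the origin over the boundary. -/
def squareRetract (p : ℝ × ℝ) : ℝ × ℝ :=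
  (max 0 (1 - max 0 (squareDist p))) • (max 0 (min 1 p.1), max 0 (min 1 p.2))

@[fun_prop]
theorem continuous_squareRetract : Continuous squareRetract := by unfold squareRetract; fun_prop

theorem squareDist_nonpos_iff {p : ℝ × ℝ} :
    squareDist p ≤ 0 ↔ (0 ≤ p.1 ∧ p.1 ≤ 1) ∧ 0 ≤ p.2 ∧ p.2 ≤ 1 := by
  simp [squareDist]

theorem squareRetract_of_nonpos {p : ℝ × ℝ} (h : squareDist p ≤ 0) : squareRetract p = p := by
  obtain ⟨⟨h1, h2⟩, h3, h4⟩ := squareDist_nonpos_iff.1 h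
  simp [squareRetract, h, h1, h2, h3, h4]

theorem squareRetract_of_one_le {p : ℝ × ℝ} (h : 1 ≤ squareDist p) : squareRetract p = 0 := by
  have h0 : max 0 (squareDist p) = squareDist p := max_eq_right (by linarith)
  have h1 : max 0 (1 - squareDist p) = 0 := max_eq_left (by linarith)
  rw [squareRetract, h0, h1, zero_smul]

/-- The expansion of the unit square to the square `[-u, 1 + u]²`. -/
def squareExpand (q : ℝ × ℝ × ℝ) : ℝ × ℝ :=
  ((1 + 2 * q.2.2) * q.1 - q.2.2, (1 + 2 * q.2.2) * q.2.1 - q.2.2)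

@[fun_prop]
theorem continuous_squareExpand : Continuous squareExpand := by unfold squareExpand; fun_prop

/-- The square `G`, extended to the plane by the collar of `F`, as a homotopy between `G` and a
sphere. -/
def collarHomotopy (F G : C(ℝ × ℝ, X)) (h : ∀ p, squareDist p = 0 → F p = G p) :
    C(ℝ × ℝ × ℝ, X) where
  toFun q := if squareDist (squareExpand q) ≤ 0 then G (squareExpand q)
    else F (squareRetract (squareExpand q))
  continuous_toFun := by
    refine Continuous.if_le (by fun_prop) (by fun_prop) (by fun_prop) (by fun_prop) fun q hq => ?_
    rw [squareRetract_of_nonpos hq.le, h _ hq]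

theorem collarHomotopy_of_nonneg {F G : C(ℝ × ℝ, X)} (h : ∀ p, squareDist p = 0 → F p = G p)
    {q : ℝ × ℝ × ℝ} (hq : 0 ≤ squareDist (squareExpand q)) :
    collarHomotopy F G h q = F (squareRetract (squareExpand q)) := by
  simp only [collarHomotopy, ContinuousMap.coe_mk]
  split_ifs with h'
  · rw [squareRetract_of_nonpos h', h _ (le_antisymm h' hq)]
  · rfl

theorem squareChain_collarHomotopy_zero {F G : C(ℝ × ℝ, X)}
    (h : ∀ p, squareDist p = 0 → F p = G p) :
    squareChain (cubeFaceThd (collarHomotopy F G h) 0) = squareChain G := by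
  refine squareChain_congr fun s hs t ht => ?_
  have e : squareExpand (s, t, 0) = (s, t) := by simp [squareExpand]
  simp only [cubeFaceThd, collarHomotopy, ContinuousMap.coe_mk, e]
  rw [if_pos (squareDist_nonpos_iff (p := (s, t)).2 ⟨⟨hs.1, hs.2⟩, ht.1, ht.2⟩)]

theorem le_squareDist_expand_fst {c t u : ℝ} (hc : c ∈ ({0, 1} : Set ℝ)) :
    u ≤ squareDist (squareExpand (c, t, u)) := by
  rcases hc with rfl | rfl
  · exact le_trans (by simp [squareExpand]) ((le_max_left _ _).trans (le_max_left _ _))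
  · refine le_trans ?_ ((le_max_right _ _).trans (le_max_left _ _))
    simp only [squareExpand]
    linarith

theorem le_squareDist_expand_snd {c s u : ℝ} (hc : c ∈ ({0, 1} : Set ℝ)) :
    u ≤ squareDist (squareExpand (s, c, u)) := by
  rcases hc with rfl | rfl
  · exact le_trans (by simp [squareExpand]) ((le_max_left _ _).trans (le_max_right _ _))
  · refine le_trans ?_ ((le_max_right _ _).trans (le_max_right _ _))
    simp only [squareExpand]
    linarith

/-- In a space with trivial `π₂`, two squares with the same boundary are homologous. -/
theorem squareChain_sub_mem_range_of_boundary_eq (hX : Pi2Trivial X) {F G : C(ℝ × ℝ, X)}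
    (h : ∀ p, squareDist p = 0 → F p = G p) :
    squareChain F - squareChain G ∈ LinearMap.range (chainBoundary 2 X) := by
  have hF : ∀ p, squareDist p = 0 → F p = F p := fun _ _ => rfl
  have hside := cube_compare (C := collarHomotopy F F hF) (C' := collarHomotopy F G h)
    (fun c hc t _ u hu => by
      have := hu.1.trans (le_squareDist_expand_fst (t := t) (u := u) hc)
      rw [collarHomotopy_of_nonneg _ this, collarHomotopy_of_nonneg _ this])
    (fun c hc s _ u hu => by
      have := hu.1.trans (le_squareDist_expand_snd (s := s) (u := u) hc)
      rw [collarHomotopy_of_nonneg _ this, collarHomotopy_of_nonneg _ this])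
  have houter : ∀ (G : C(ℝ × ℝ, X)) (h : ∀ p, squareDist p = 0 → F p = G p) (q : ℝ × ℝ × ℝ),
      1 ≤ squareDist (squareExpand q) → collarHomotopy F G h q = F 0 := fun G h q hq => by
    rw [collarHomotopy_of_nonneg h (zero_le_one.trans hq), squareRetract_of_one_le hq]
  have htop := squareChain_sub_mem_range_of_boundary_const hX
    (L := cubeFaceThd (collarHomotopy F F hF) 1) (L' := cubeFaceThd (collarHomotopy F G h) 1)
    (x₀ := F 0)
    (fun c hc t _ => ⟨houter F hF _ (le_squareDist_expand_fst hc),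
      houter G h _ (le_squareDist_expand_fst hc)⟩)
    (fun c hc t _ => ⟨houter F hF _ (le_squareDist_expand_snd hc),
      houter G h _ (le_squareDist_expand_snd hc)⟩)
  rw [squareChain_collarHomotopy_zero, squareChain_collarHomotopy_zero] at hside
  convert Submodule.sub_mem _ htop hside using 1
  abel

end secondHomotopy

/-- Maps from contractible spaces lift through surjective covering maps. -/
theorem IsCoveringMap.exists_lift_of_contractible {E B A : Type*} [TopologicalSpace E]
    [TopologicalSpace B] [TopologicalSpace A] [ContractibleSpace A] {p : E → B}
    (cov : IsCoveringMap p) (hp : Function.Surjective p) (f : C(A, B)) :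
    ∃ g : C(A, E), ∀ a, p (g a) = f a := by
  obtain ⟨y, ⟨K⟩⟩ := id_nullhomotopic A
  obtain ⟨e, he⟩ := hp (f y)
  let F : C(I × A, B) := f.comp K.symm.toContinuousMap
  have hF : ∀ a, F (0, a) = p (ContinuousMap.const A e a) := fun a =>
    (congrArg f (K.symm.apply_zero a)).trans he.symm
  refine ⟨(cov.liftHomotopy F (ContinuousMap.const A e) hF).comp
    ⟨fun a => (1, a), by fun_prop⟩, fun a => ?_⟩
  exact (congrFun (cov.liftHomotopy_lifts F (ContinuousMap.const A e) hF) (1, a)).trans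
    (congrArg f (K.symm.apply_one a))

/-- The unit complex numbers are homeomorphic to the unit sphere of the Euclidean plane. -/
def circleHomeomorph : Circle ≃ₜ unitSphere 1 :=
  Homeomorph.subtype (Complex.orthonormalBasisOneI.repr.toHomeomorph) fun z => by
    simp [Submonoid.unitSphere]

/-- The universal covering of the circle. -/
def circleCover : C(ℝ, unitSphere 1) :=
  ⟨circleHomeomorph ∘ Circle.exp, circleHomeomorph.continuous.comp Circle.exp.continuous⟩

theorem isCoveringMap_circleCover : IsCoveringMap circleCover :=
  Circle.isCoveringMap_exp.homeomorph_comp circleHomeomorph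

theorem circleCover_surjective : Function.Surjective circleCover :=
  circleHomeomorph.surjective.comp Circle.exp_surjective

theorem circleCover_eq_iff {s t : ℝ} :
    circleCover s = circleCover t ↔ ∃ n : ℤ, s = t + n * (2 * Real.pi) :=
  circleHomeomorph.injective.eq_iff.trans Circle.exp_eq_exp

theorem exists_circle_lift {A : Type*} [TopologicalSpace A] [ContractibleSpace A]
    (τ : C(A, unitSphere 1)) : ∃ g : C(A, ℝ), ∀ a, circleCover (g a) = τ a :=
  isCoveringMap_circleCover.exists_lift_of_contractible circleCover_surjective τ

/-- Two lifts of the same map to the circle differ by a constant. -/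
theorem circle_lift_sub_eq {A : Type*} [TopologicalSpace A] [PreconnectedSpace A]
    {g g' : C(A, ℝ)} (h : ∀ a, circleCover (g a) = circleCover (g' a)) (a b : A) :
    g a - g b = g' a - g' b := by
  obtain ⟨n, hn⟩ := circleCover_eq_iff.1 (h b)
  have := isCoveringMap_circleCover.eq_of_comp_eq (g₁ := fun x => g x)
    (g₂ := fun x => g' x + n * (2 * Real.pi)) g.continuous (by fun_prop) (by
      funext x
      exact (h x).trans (circleCover_eq_iff.2 ⟨-n, by push_cast; ring⟩)) b hn
  have ha := congrFun this a
  linarith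

instance (n : ℕ) : ContractibleSpace (stdSimplex ℝ (Fin (n + 1))) :=
  (convex_stdSimplex ℝ (Fin (n + 1))).contractibleSpace ⟨_, (stdSimplex.vertex 0).2⟩

/-- The product of two lifts of angles on the edges of a triangle. -/
def edgeProduct (x y : C(stdSimplex ℝ (Fin 3), ℝ)) : ℝ :=
  (x (stdSimplex.vertex 1) - x (stdSimplex.vertex 0)) *
    (y (stdSimplex.vertex 2) - y (stdSimplex.vertex 1))

/-- The volume cocycle of the torus. -/
def torusCocycle (τ : C(stdSimplex ℝ (Fin 3), Torus2)) : ℝ :=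
  edgeProduct (exists_circle_lift (ContinuousMap.fst.comp τ)).choose
    (exists_circle_lift (ContinuousMap.snd.comp τ)).choose

theorem torusCocycle_eq {τ : C(stdSimplex ℝ (Fin 3), Torus2)} {x y : C(stdSimplex ℝ (Fin 3), ℝ)}
    (h : ∀ a, τ a = (circleCover (x a), circleCover (y a))) :
    torusCocycle τ = edgeProduct x y := by
  unfold torusCocycle edgeProduct
  congr 1 <;> refine circle_lift_sub_eq (fun a => ?_) _ _
  · exact ((exists_circle_lift (ContinuousMap.fst.comp τ)).choose_spec a).trans
      (congrArg Prod.fst (h a))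
  · exact ((exists_circle_lift (ContinuousMap.snd.comp τ)).choose_spec a).trans
      (congrArg Prod.snd (h a))

theorem torusCocycle_comp_chainBoundary :
    chainFunctional torusCocycle ∘ₗ chainBoundary 2 Torus2 = 0 := by
  refine chain_hom_ext fun τ => ?_
  obtain ⟨x, hx⟩ := exists_circle_lift (ContinuousMap.fst.comp τ)
  obtain ⟨y, hy⟩ := exists_circle_lift (ContinuousMap.snd.comp τ)
  have key : ∀ i : Fin 4, torusCocycle (τ.comp (simplexFace i)) =
      edgeProduct (x.comp (simplexFace i)) (y.comp (simplexFace i)) := fun i =>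
    torusCocycle_eq fun a => Prod.ext (hx _).symm (hy _).symm
  rw [LinearMap.comp_apply, chainBoundary_simplexChain, map_sum, LinearMap.zero_apply]
  simp only [map_zsmul, chainFunctional_simplexChain, key]
  simp only [edgeProduct, ContinuousMap.comp_apply, simplexFace, ContinuousMap.coe_mk,
    stdSimplex.map_vertex]
  rw [Fin.sum_univ_four]
  have h00 : (0 : Fin 4).succAbove (0 : Fin 3) = 1 := rfl
  have h01 : (0 : Fin 4).succAbove (1 : Fin 3) = 2 := rfl
  have h02 : (0 : Fin 4).succAbove (2 : Fin 3) = 3 := rfl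
  have h10 : (1 : Fin 4).succAbove (0 : Fin 3) = 0 := rfl
  have h11 : (1 : Fin 4).succAbove (1 : Fin 3) = 2 := rfl
  have h12 : (1 : Fin 4).succAbove (2 : Fin 3) = 3 := rfl
  have h20 : (2 : Fin 4).succAbove (0 : Fin 3) = 0 := rfl
  have h21 : (2 : Fin 4).succAbove (1 : Fin 3) = 1 := rfl
  have h22 : (2 : Fin 4).succAbove (2 : Fin 3) = 3 := rfl
  have h30 : (3 : Fin 4).succAbove (0 : Fin 3) = 0 := rfl
  have h31 : (3 : Fin 4).succAbove (1 : Fin 3) = 1 := rfl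
  have h32 : (3 : Fin 4).succAbove (2 : Fin 3) = 2 := rfl
  rw [h00, h01, h02, h10, h11, h12, h20, h21, h22, h30, h31, h32]
  simp [pow_succ]
  ring

/-- The value of the volume cocycle on a square, in terms of a lift to the plane. -/
theorem torusCocycle_squareChain {Q : C(ℝ × ℝ, Torus2)} {x y : C(ℝ × ℝ, ℝ)}
    (h : ∀ a, Q a = (circleCover (x a), circleCover (y a))) :
    chainFunctional torusCocycle (squareChain Q) =
      (x (1, 0) - x (0, 0)) * (y (1, 1) - y (1, 0)) -
        (x (0, 1) - x (0, 0)) * (y (1, 1) - y (0, 1)) := by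
  have hv : ∀ (w : Fin 3 → ℝ × ℝ) (i : Fin 3),
      affineSimplex w (stdSimplex.vertex i) = w i := fun w i => by
    rw [affineSimplex_apply]
    simp [Pi.single_apply]
  have key : ∀ w : Fin 3 → ℝ × ℝ, torusCocycle (Q.comp (affineSimplex w)) =
      edgeProduct (x.comp (affineSimplex w)) (y.comp (affineSimplex w)) := fun w =>
    torusCocycle_eq fun a => h _
  simp only [squareChain, affineChain, map_sub, chainFunctional_simplexChain, key, edgeProduct,
    ContinuousMap.comp_apply, hv]
  simp

section nullhomotopy
variable {X : Type} [TopologicalSpace X]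

/-- The homotopy which compresses the middle of a square along a null-homotopy of its bottom
edge. -/
def compressionHomotopy (D : C(ℝ × ℝ, X)) (ℓ : C(ℝ, X)) {x₀ : X}
    (hD : ∀ s, ∀ u ≥ 1, D (s, u) = x₀) (hℓ : ∀ t, 1 / 6 ≤ |t - 1 / 2| → ℓ t = x₀) :
    C(ℝ × ℝ × ℝ, X) where
  toFun q := if |q.2.1 - 1 / 2| ≤ 1 / 6 then ℓ q.2.1
    else D (q.1, max q.2.2 (3 / 2 - 3 * |q.2.1 - 1 / 2|))
  continuous_toFun := by
    refine Continuous.if_le (by fun_prop) (by fun_prop) (by fun_prop) (by fun_prop) fun q hq => ?_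
    rw [hℓ _ hq.ge, hD _ _ (le_max_of_le_right (by rw [hq]; norm_num))]

/-- In a space with trivial `π₂`, a torus with a null-homotopic meridian is null-homologous. -/
theorem squareChain_mem_range_of_nullhomotopic (hX : Pi2Trivial X) {F D : C(ℝ × ℝ, X)}
    {ℓ : C(ℝ, X)} {x₀ : X} (hD : ∀ s, ∀ u ≥ 1, D (s, u) = x₀)
    (hD' : ∀ c ∈ ({0, 1} : Set ℝ), ∀ u, D (c, u) = x₀)
    (hℓ : ∀ t, 1 / 6 ≤ |t - 1 / 2| → ℓ t = x₀)
    (hF : ∀ c ∈ ({0, 1} : Set ℝ), ∀ t, F (c, t) = ℓ t)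
    (hF' : ∀ c ∈ ({0, 1} : Set ℝ), ∀ s, F (s, c) = D (s, 0)) :
    squareChain F ∈ LinearMap.range (chainBoundary 2 X) := by
  let K := compressionHomotopy D ℓ hD hℓ
  have hside : ∀ c ∈ ({0, 1} : Set ℝ), ∀ t u, K (c, t, u) = ℓ t := fun c hc t u => by
    simp only [K, compressionHomotopy, ContinuousMap.coe_mk]
    split_ifs with h
    · rfl
    · rw [hD' c hc, hℓ t (not_le.1 h).le]
  have hend : ∀ c ∈ ({0, 1} : Set ℝ), ∀ s u, K (s, c, u) = D (s, max u 0) := fun c hc s u => by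
    have hc' : |c - 1 / 2| = 1 / 2 := by
      rcases hc with rfl | rfl <;> norm_num [abs_of_pos, abs_of_neg]
    simp only [K, compressionHomotopy, ContinuousMap.coe_mk, hc']
    norm_num
  have hK := cube_top_sub_bottom (C := K)
    (fun t _ u _ => (hside 0 (by simp) t u).trans (hside 1 (by simp) t u).symm)
    (fun s _ u _ => (hend 0 (by simp) s u).trans (hend 1 (by simp) s u).symm)
  have htop : cubeFaceThd K 1 = ℓ.comp ⟨Prod.snd, continuous_snd⟩ := by
    ext p
    simp only [cubeFaceThd, K, compressionHomotopy, ContinuousMap.coe_mk, ContinuousMap.comp_apply]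
    split_ifs with h
    · rfl
    · rw [hD _ _ (le_max_left _ _), hℓ _ (not_le.1 h).le]
  have hbot : ∀ p, squareDist p = 0 → F p = cubeFaceThd K 0 p := by
    rintro ⟨s, t⟩ hp
    obtain ⟨⟨h1, h2⟩, h3, h4⟩ := squareDist_nonpos_iff.1 hp.le
    have h : s ∈ ({0, 1} : Set ℝ) ∨ t ∈ ({0, 1} : Set ℝ) := by
      simp only [squareDist] at hp
      by_contra! hc
      simp only [Set.mem_insert_iff, Set.mem_singleton_iff, not_or] at hc
      have : max (max (-s) (s - 1)) (max (-t) (t - 1)) < 0 := by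
        simp only [max_lt_iff]
        refine ⟨⟨?_, ?_⟩, ?_, ?_⟩
        · exact neg_lt_zero.2 (lt_of_le_of_ne h1 (Ne.symm hc.1.1))
        · exact sub_neg.2 (lt_of_le_of_ne h2 hc.1.2)
        · exact neg_lt_zero.2 (lt_of_le_of_ne h3 (Ne.symm hc.2.1))
        · exact sub_neg.2 (lt_of_le_of_ne h4 hc.2.2)
      exact this.ne hp
    change F (s, t) = K (s, t, 0)
    rcases h with h | h
    · rw [hF s h, hside s h]
    · rw [hF' t h, hend t h, max_self]
  have hsub := squareChain_sub_mem_range_of_boundary_eq hX hbot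
  have hdeg := squareChain_degenerate_mem_range ℓ
    ((hℓ 0 (by norm_num [abs_of_neg])).trans (hℓ 1 (by norm_num [abs_of_pos])).symm)
  rw [htop] at hK
  convert Submodule.add_mem _ (Submodule.sub_mem _ hsub hK) hdeg using 1
  abel

end nullhomotopy

/-- The universal covering of the torus. -/
def torusCover : C(ℝ × ℝ, Torus2) := circleCover.prodMap circleCover

theorem torusCover_add (p : ℝ × ℝ) (m n : ℤ) :
    torusCover (p + ((m : ℝ) * (2 * Real.pi), (n : ℝ) * (2 * Real.pi))) = torusCover p :=
  Prod.ext (circleCover_eq_iff.2 ⟨m, rfl⟩) (circleCover_eq_iff.2 ⟨n, rfl⟩)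

theorem exists_torus_lift {A : Type*} [TopologicalSpace A] [ContractibleSpace A]
    (τ : C(A, Torus2)) : ∃ g : C(A, ℝ × ℝ), ∀ a, torusCover (g a) = τ a := by
  obtain ⟨x, hx⟩ := exists_circle_lift (ContinuousMap.fst.comp τ)
  obtain ⟨y, hy⟩ := exists_circle_lift (ContinuousMap.snd.comp τ)
  exact ⟨x.prodMk y, fun a => Prod.ext (hx a) (hy a)⟩

/-- A loop in the torus whose lift is closed is null-homotopic. -/
theorem homotopic_refl_of_lift_closed {x : Torus2} (γ : Path x x) {g : C(I, ℝ × ℝ)}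
    (hg : ∀ s, torusCover (g s) = γ s) (h : g 1 = g 0) : γ.Homotopic (Path.refl x) := by
  obtain rfl : torusCover (g 0) = x := (hg 0).trans γ.source
  have := (SimplyConnectedSpace.paths_homotopic (⟨g, rfl, h⟩ : Path (g 0) (g 0))
    (Path.refl (g 0))).map torusCover
  exact (Path.ext (funext fun s => (hg s).symm) :
    γ = Path.map (⟨g, rfl, h⟩ : Path (g 0) (g 0)) torusCover.continuous) ▸ this

/-- The piecewise linear function which is `0` up to `1 / 3` and `1` from `2 / 3` on. -/
def middleRamp (t : ℝ) : ℝ := max 0 (min 1 (3 * t - 1))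

@[fun_prop]
theorem continuous_middleRamp : Continuous middleRamp := by unfold middleRamp; fun_prop

theorem middleRamp_of_le {t : ℝ} (h : t ≤ 1 / 3) : middleRamp t = 0 :=
  max_eq_left ((min_le_right _ _).trans (by linarith))

theorem middleRamp_of_ge {t : ℝ} (h : 2 / 3 ≤ t) : middleRamp t = 1 := by
  rw [middleRamp, min_eq_left (by linarith), max_eq_right zero_le_one]

/-- In a space with trivial `π₂`, a map from the torus which is non-trivial on the second homology
does not kill essential loops. -/
theorem homotopic_refl_of_Hmap_ne_zero {X : Type} [TopologicalSpace X] (hX : Pi2Trivial X)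
    {ωT : H 2 Torus2} (hωT : IsGenerator ωT) {f : C(Torus2, X)} (hf : Hmap 2 f ωT ≠ 0)
    {x : Torus2} (γ : Path x x) (hγ : (γ.map f.continuous).Homotopic (Path.refl (f x))) :
    γ.Homotopic (Path.refl x) := by
  have : ContractibleSpace I :=
    (convex_Icc (0 : ℝ) 1).contractibleSpace ⟨0, Set.left_mem_Icc.2 zero_le_one⟩
  obtain ⟨g, hg⟩ := exists_torus_lift (γ : C(I, Torus2))
  replace hg : ∀ s, torusCover (g s) = γ s := hg
  have hloop : torusCover (g 1) = torusCover (g 0) := by rw [hg, hg, γ.source, γ.target]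
  obtain ⟨m, hm⟩ := circleCover_eq_iff.1 (congrArg Prod.fst hloop)
  obtain ⟨n, hn⟩ := circleCover_eq_iff.1 (congrArg Prod.snd hloop)
  refine homotopic_refl_of_lift_closed γ hg ?_
  by_contra hne
  refine hf ?_
  obtain ⟨D⟩ := hγ
  let w : ℝ × ℝ := (((-n : ℤ) : ℝ) * (2 * Real.pi), (m : ℝ) * (2 * Real.pi))
  let proj : ℝ → I := Set.projIcc 0 1 zero_le_one
  have hproj : Continuous proj := continuous_projIcc
  let G : C(ℝ × ℝ, ℝ × ℝ) := ⟨fun p => g (proj p.1) + middleRamp p.2 • w, by fun_prop⟩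
  have hg1 : g 1 = g 0 + ((m : ℝ) * (2 * Real.pi), (n : ℝ) * (2 * Real.pi)) := Prod.ext hm hn
  have hp0 : proj 0 = 0 := Set.projIcc_left _
  have hp1 : proj 1 = 1 := Set.projIcc_right _
  have hr0 : middleRamp 0 = 0 := middleRamp_of_le (by norm_num)
  have hr1 : middleRamp 1 = 1 := middleRamp_of_ge (by norm_num)
  have hG1 : ∀ t, torusCover (G (1, t)) = torusCover (G (0, t)) := fun t => by
    simp only [G, ContinuousMap.coe_mk, hp0, hp1, hg1]
    rw [add_right_comm, torusCover_add]
  have hGs : ∀ (s r : ℝ), r = 0 ∨ r = 1 → torusCover (g (proj s) + r • w) = γ (proj s) := by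
    rintro s r (rfl | rfl)
    · rw [zero_smul, add_zero, hg]
    · rw [one_smul, torusCover_add, hg]
  have hGr : ∀ s t, 1 / 6 ≤ |t - 1 / 2| → torusCover (G (s, t)) = γ (proj s) := fun s t ht => by
    refine hGs s (middleRamp t) ?_
    rcases le_abs'.1 ht with h | h
    · exact Or.inl (middleRamp_of_le (by linarith))
    · exact Or.inr (middleRamp_of_ge (by linarith))
  let Q : C(ℝ × ℝ, Torus2) := torusCover.comp G
  refine Hmap_eq_zero_of_cycle f ωT hωT _ torusCocycle_comp_chainBoundary (squareChain Q) ?_ ?_ ?_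
  · refine chainBoundary_squareChain (fun t _ => (hG1 t).symm) fun s _ => ?_
    exact (hGr s 0 (by norm_num [abs_of_neg])).trans (hGr s 1 (by norm_num [abs_of_pos])).symm
  · rw [torusCocycle_squareChain (x := ContinuousMap.fst.comp G) (y := ContinuousMap.snd.comp G)
      fun _ => rfl]
    simp only [ContinuousMap.comp_apply, G, ContinuousMap.coe_mk, hp0, hp1, hr0, hr1, hg1, w]
    intro h0
    have h0' : (2 * Real.pi) ^ 2 * ((m : ℝ) ^ 2 + (n : ℝ) ^ 2) = 0 := by
      simp at h0
      linear_combination h0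
    have hmn : (m : ℝ) ^ 2 + (n : ℝ) ^ 2 = 0 :=
      (mul_eq_zero.1 h0').resolve_left (pow_ne_zero _ (by positivity))
    have hm0 : (m : ℝ) = 0 := by nlinarith [sq_nonneg (m : ℝ), sq_nonneg (n : ℝ)]
    have hn0 : (n : ℝ) = 0 := by nlinarith [sq_nonneg (m : ℝ), sq_nonneg (n : ℝ)]
    exact hne (by rw [hg1, hm0, hn0]; simp)
  · rw [chainMap_squareChain]
    refine squareChain_mem_range_of_nullhomotopic hX (x₀ := f x)
      (D := ⟨fun p => D (proj p.2, proj p.1), by fun_prop⟩)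
      (ℓ := f.comp (Q.comp ⟨fun t => (0, t), by fun_prop⟩)) ?_ ?_ ?_ ?_ ?_
    · intro s u hu
      have : proj u = 1 := Set.projIcc_of_right_le _ hu
      simp [this]
    · rintro c (rfl | rfl) u
      · simp [hp0]
      · simp [hp1]
    · intro t ht
      simp only [Q, ContinuousMap.comp_apply, ContinuousMap.coe_mk, hGr _ _ ht, hp0, γ.source]
    · rintro c (rfl | rfl) t
      · rfl
      · exact congrArg f (hG1 t)
    · rintro c (rfl | rfl) s
      · simp only [Q, ContinuousMap.comp_apply, ContinuousMap.coe_mk, hp0]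
        rw [hGr s 0 (by norm_num [abs_of_neg])]
        simp
      · simp only [Q, ContinuousMap.comp_apply, ContinuousMap.coe_mk, hp0]
        rw [hGr s 1 (by norm_num [abs_of_pos])]
        simp

theorem π₁map_injective_of_Hmap_ne_zero {X : Type} [TopologicalSpace X] (hX : Pi2Trivial X)
    {ωT : H 2 Torus2} (hωT : IsGenerator ωT) {f : C(Torus2, X)} (hf : Hmap 2 f ωT ≠ 0)
    (x : Torus2) : Function.Injective (π₁map f x) := by
  refine (injective_iff_map_eq_one _).2 fun φ hφ => ?_
  obtain ⟨γ, hγ⟩ := Quotient.exists_rep (s := Path.Homotopic.setoid x x) φ.hom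
  have h : (π₁map f x φ).hom = 𝟙 (FundamentalGroupoid.mk (f x)) := congrArg Iso.hom hφ
  have hγ' : (γ.map f.continuous).Homotopic (Path.refl (f x)) := by
    refine Quotient.exact (s := Path.Homotopic.setoid (f x) (f x)) (Eq.trans ?_ h)
    have : (π₁map f x φ).hom = (Path.Homotopic.Quotient.map φ.hom f) := rfl
    rw [this, ← hγ]
    rfl
  refine Iso.ext (hγ.symm.trans ?_)
  exact Quotient.sound (s := Path.Homotopic.setoid x x)
    (homotopic_refl_of_Hmap_ne_zero hX hωT hf γ hγ')

/-- **Lemma.**  Let `X` be a topological space with `π₂(X) = 0`.  Then every toroidal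
class in `H₂(X; ℚ)` has a `π₁`-injective representative. -/
theorem toroidal_class_has_pi1_injective_representative
    (X : Type) [TopologicalSpace X] (hX : Pi2Trivial X)
    (ωT : H 2 Torus2) (hωT : IsGenerator ωT)
    (v : H 2 X) (hv : v ≠ 0)
    (f : C(Torus2, X)) (α : ℚ) (hα : α ≠ 0) (hf : Hmap 2 f ωT = α • v) :
    ∃ (g : C(Torus2, X)) (β : ℚ), β ≠ 0 ∧ Hmap 2 g ωT = β • v ∧
      ∀ x : Torus2, Function.Injective (π₁map g x) :=
  ⟨f, α, hα, hf, π₁map_injective_of_Hmap_ne_zero hX hωT (hf ▸ smul_ne_zero hα hv)⟩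

end
end

section
/- Let X be a topological space and let u ∈ H²(X; ℚ) be an atoroidal class. Then the topological complexity weight of the zero divisor ū = 1 × u − u × 1 ∈ H²(X × X; ℚ) equals 2, i.e., wgt_TC(ū) = 2. -/
/-!
Common definitions: rational singular (co)homology, homotopy groups and asphericity,
classifying maps, closed oriented manifolds, connected sums, wedges, topological
complexity, sectional category weights, and (a)toroidal classes.
-/

open CategoryTheory unitInterval Topology

noncomputable section

section

/-- The standard topological `n`-simplex. -/
abbrev TopSimplex (n : ℕ) : Type := stdSimplex ℝ (Fin (n + 1))

/-- Rational singular `n`-chains. -/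
abbrev SingChain (n : ℕ) (Y : Type) [TopologicalSpace Y] : Type := C(TopSimplex n, Y) →₀ ℚ

/-- The inclusion of the `i`-th face. -/
def faceInclusion (n : ℕ) (i : Fin (n + 2)) : C(TopSimplex n, TopSimplex (n + 1)) :=
  ⟨stdSimplex.map i.succAbove, stdSimplex.continuous_map _⟩

variable {X Y Z : Type} [TopologicalSpace X] [TopologicalSpace Y] [TopologicalSpace Z]

/-- The singular boundary operator. -/
def singBoundary (n : ℕ) : SingChain (n + 1) Y →ₗ[ℚ] SingChain n Y :=
  Finsupp.linearCombination ℚ fun τ =>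
    ∑ i : Fin (n + 2), (-1 : ℚ) ^ (i : ℕ) • Finsupp.single (τ.comp (faceInclusion n i)) 1

/-- The map induced on singular chains. -/
def chainPush (n : ℕ) (f : C(Y, Z)) : SingChain n Y →ₗ[ℚ] SingChain n Z :=
  Finsupp.lmapDomain ℚ ℚ fun τ => f.comp τ

@[simp] lemma singBoundary_single (n : ℕ) (τ : C(TopSimplex (n + 1), Y)) (a : ℚ) :
    singBoundary n (Finsupp.single τ a) =
      a • ∑ i : Fin (n + 2), (-1 : ℚ) ^ (i : ℕ) •
        Finsupp.single (τ.comp (faceInclusion n i)) 1 := by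
  simp [singBoundary]

@[simp] lemma chainPush_single (n : ℕ) (f : C(Y, Z)) (τ : C(TopSimplex n, Y)) (a : ℚ) :
    chainPush n f (Finsupp.single τ a) = Finsupp.single (f.comp τ) a := by
  simp [chainPush]

lemma chainPush_singBoundary (n : ℕ) (f : C(Y, Z)) (w : SingChain (n + 1) Y) :
    chainPush n f (singBoundary n w) = singBoundary n (chainPush (n + 1) f w) := by
  induction w using Finsupp.induction_linear with
  | zero => simp
  | add a b ha hb => simp [ha, hb]
  | single τ a => simp [ContinuousMap.comp_assoc]

/-- Identification of the terms of the frozen singular complex with `SingChain`. -/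
def chainEquiv (n : ℕ) (Y : Type) [TopologicalSpace Y] :
    (singularChainComplex.obj (TopCat.of Y)).X n ≃ₗ[ℚ] SingChain n Y :=
  Finsupp.domLCongr (TopCat.toSSetObjEquiv (TopCat.of Y) (Opposite.op (SimplexCategory.mk n)))

lemma chainEquiv_single (n : ℕ)
    (τ : (TopCat.toSSet.obj (TopCat.of Y)).obj (Opposite.op (SimplexCategory.mk n))) :
    chainEquiv n Y (Finsupp.single τ 1 : _ →₀ ℚ) =
      Finsupp.single (TopCat.toSSetObjEquiv (TopCat.of Y) _ τ) 1 :=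
  Finsupp.domLCongr_single (R := ℚ) _ _ _

lemma chainEquiv_d (n : ℕ) (x : (singularChainComplex.obj (TopCat.of Y)).X (n + 1)) :
    chainEquiv n Y ((singularChainComplex.obj (TopCat.of Y)).d (n + 1) n x) =
      singBoundary n (chainEquiv (n + 1) Y x) := by
  let S : SimplicialObject (ModuleCat ℚ) :=
    ((SimplicialObject.whiskering _ _).obj (ModuleCat.free ℚ)).obj
          (TopCat.toSSet.obj (TopCat.of Y))
  have hd : (singularChainComplex.obj (TopCat.of Y)).d (n + 1) n =
      ∑ i : Fin (n + 2), (-1 : ℤ) ^ (i : ℕ) • S.δ i :=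
    AlgebraicTopology.alternatingFaceMapComplex_obj_d _ _
  have hδ (i : Fin (n + 2))
      (τ : (TopCat.toSSet.obj (TopCat.of Y)).obj (Opposite.op (SimplexCategory.mk (n + 1)))) :
      chainEquiv n Y ((S.δ i).hom (Finsupp.single τ 1 : _ →₀ ℚ)) =
        Finsupp.single ((TopCat.toSSetObjEquiv (TopCat.of Y) _ τ).comp (faceInclusion n i)) 1 := by
    have : (S.δ i).hom (Finsupp.single τ 1 : _ →₀ ℚ) =
        (Finsupp.single ((TopCat.toSSet.obj (TopCat.of Y)).δ i τ) 1 : _ →₀ ℚ) :=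
      Finsupp.mapDomain_single
    rw [this]
    exact chainEquiv_single n _
  suffices h : (chainEquiv n Y).toLinearMap ∘ₗ
      ((singularChainComplex.obj (TopCat.of Y)).d (n + 1) n).hom =
      singBoundary n ∘ₗ (chainEquiv (n + 1) Y).toLinearMap from LinearMap.congr_fun h x
  refine Finsupp.lhom_ext' fun τ => LinearMap.ext_ring ?_
  have h1 : singBoundary n (chainEquiv (n + 1) Y (Finsupp.single τ 1 : _ →₀ ℚ)) = _ :=
    (congrArg _ (chainEquiv_single (n + 1) τ)).trans (singBoundary_single _ _ _)
  refine Eq.trans ?_ h1.symm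
  rw [hd, one_smul]
  have key (t : S.obj (Opposite.op (SimplexCategory.mk (n + 1)))) :
      chainEquiv n Y ((∑ i : Fin (n + 2), (-1 : ℤ) ^ (i : ℕ) • S.δ i).hom t) =
        ∑ i : Fin (n + 2), (-1 : ℚ) ^ (i : ℕ) • chainEquiv n Y ((S.δ i).hom t) := by
    rw [ModuleCat.hom_sum, LinearMap.sum_apply]
    refine (map_sum (chainEquiv n Y) _ _).trans (Finset.sum_congr rfl fun i _ => ?_)
    rw [ModuleCat.hom_zsmul, LinearMap.smul_apply]
    refine (map_zsmul (chainEquiv n Y) _ _).trans ?_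
    rw [← Int.cast_smul_eq_zsmul ℚ]
    push_cast
    rfl
  exact (key _).trans (Finset.sum_congr rfl fun i _ => congrArg _ (hδ i τ))

lemma chainEquiv_map (n : ℕ) (f : C(Y, Z)) (x : (singularChainComplex.obj (TopCat.of Y)).X n) :
    chainEquiv n Z ((singularChainComplex.map (TopCat.ofHom f)).f n x) =
      chainPush n f (chainEquiv n Y x) := by
  suffices h : (chainEquiv n Z).toLinearMap ∘ₗ
      ((singularChainComplex.map (TopCat.ofHom f)).f n).hom =
      chainPush n f ∘ₗ (chainEquiv n Y).toLinearMap from LinearMap.congr_fun h x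
  refine Finsupp.lhom_ext' fun τ => LinearMap.ext_ring ?_
  have h1 : chainPush n f (chainEquiv n Y (Finsupp.single τ 1 : _ →₀ ℚ)) = _ :=
    (congrArg _ (chainEquiv_single n τ)).trans (chainPush_single _ _ _ _)
  refine Eq.trans ?_ h1.symm
  have h2 : ((singularChainComplex.map (TopCat.ofHom f)).f n).hom (Finsupp.single τ 1 : _ →₀ ℚ) =
      (Finsupp.single ((TopCat.toSSet.map (TopCat.ofHom f)).app _ τ) 1 : _ →₀ ℚ) :=
    Finsupp.mapDomain_single
  change chainEquiv n Z (((singularChainComplex.map (TopCat.ofHom f)).f n).hom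
    (Finsupp.single τ 1 : _ →₀ ℚ)) = _
  rw [h2]
  exact chainEquiv_single n _

/-- The inclusion of concrete singular cycles into the singular complex. -/
def cycleInclusion (n : ℕ) (Y : Type) [TopologicalSpace Y] :
    ModuleCat.of ℚ (LinearMap.ker (singBoundary (Y := Y) n)) ⟶
      (singularChainComplex.obj (TopCat.of Y)).X (n + 1) :=
  ModuleCat.ofHom ((chainEquiv (n + 1) Y).symm.toLinearMap ∘ₗ Submodule.subtype _)

lemma cycleInclusion_d (n : ℕ) :
    cycleInclusion n Y ≫ (singularChainComplex.obj (TopCat.of Y)).d (n + 1) n = 0 := by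
  ext z
  apply (chainEquiv n Y).injective
  have := chainEquiv_d n ((chainEquiv (n + 1) Y).symm z.1)
  rw [LinearEquiv.apply_symm_apply, z.2] at this
  exact this.trans (map_zero (chainEquiv n Y)).symm

/-- The map from concrete singular cycles to the cycles of the singular complex. -/
def cycleLift (n : ℕ) (Y : Type) [TopologicalSpace Y] :
    ModuleCat.of ℚ (LinearMap.ker (singBoundary (Y := Y) n)) ⟶
      (singularChainComplex.obj (TopCat.of Y)).cycles (n + 1) :=
  (singularChainComplex.obj (TopCat.of Y)).liftCycles (cycleInclusion n Y) n
    (by simp) (cycleInclusion_d n)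

lemma iCycles_cycleLift (n : ℕ) (z : LinearMap.ker (singBoundary (Y := Y) n)) :
    chainEquiv (n + 1) Y ((singularChainComplex.obj (TopCat.of Y)).iCycles (n + 1)
      (cycleLift n Y z)) = z.1 := by
  have h : (singularChainComplex.obj (TopCat.of Y)).iCycles (n + 1) (cycleLift n Y z) =
      cycleInclusion n Y z :=
    ConcreteCategory.congr_hom ((singularChainComplex.obj (TopCat.of Y)).liftCycles_i
      (cycleInclusion n Y) n (by simp) (cycleInclusion_d n)) z
  rw [h]
  exact (chainEquiv (n + 1) Y).apply_symm_apply z.1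

/-- The homology class of a singular cycle. -/
def cycleClass (n : ℕ) (Y : Type) [TopologicalSpace Y] :
    LinearMap.ker (singBoundary (Y := Y) n) →ₗ[ℚ] H (n + 1) Y :=
  (cycleLift n Y ≫ (singularChainComplex.obj (TopCat.of Y)).homologyπ (n + 1)).hom

lemma cycleClass_eq (n : ℕ) (z : LinearMap.ker (singBoundary (Y := Y) n))
    (y : (singularChainComplex.obj (TopCat.of Y)).cycles (n + 1))
    (hy : chainEquiv (n + 1) Y ((singularChainComplex.obj (TopCat.of Y)).iCycles (n + 1) y) = z.1) :
    cycleClass n Y z = (singularChainComplex.obj (TopCat.of Y)).homologyπ (n + 1) y := by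
  have : cycleLift n Y z = y := by
    apply (ModuleCat.mono_iff_injective
      ((singularChainComplex.obj (TopCat.of Y)).iCycles (n + 1))).1 inferInstance
    apply (chainEquiv (n + 1) Y).injective
    rw [hy, iCycles_cycleLift]
  exact congrArg ((singularChainComplex.obj (TopCat.of Y)).homologyπ (n + 1)) this

lemma cycleClass_surjective (n : ℕ) : Function.Surjective (cycleClass n Y) := by
  intro x
  obtain ⟨y, rfl⟩ := (ModuleCat.epi_iff_surjective
    ((singularChainComplex.obj (TopCat.of Y)).homologyπ (n + 1))).1 inferInstance x
  refine ⟨⟨chainEquiv (n + 1) Y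
    ((singularChainComplex.obj (TopCat.of Y)).iCycles (n + 1) y), ?_⟩, cycleClass_eq n _ y rfl⟩
  rw [LinearMap.mem_ker, ← chainEquiv_d, ← ConcreteCategory.comp_apply,
    HomologicalComplex.iCycles_d]
  simp

lemma singBoundary_singBoundary (n : ℕ) (w : SingChain (n + 2) Y) :
    singBoundary n (singBoundary (n + 1) w) = 0 := by
  obtain ⟨x, rfl⟩ := (chainEquiv (n + 2) Y).surjective w
  rw [← chainEquiv_d, ← chainEquiv_d, ← ConcreteCategory.comp_apply, HomologicalComplex.d_comp_d]
  simp

lemma cycleClass_singBoundary (n : ℕ) (w : SingChain (n + 2) Y) :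
    cycleClass n Y ⟨singBoundary (n + 1) w, singBoundary_singBoundary n w⟩ = 0 := by
  rw [cycleClass_eq n _ ((singularChainComplex.obj (TopCat.of Y)).toCycles (n + 2) (n + 1)
    ((chainEquiv (n + 2) Y).symm w)), ← ConcreteCategory.comp_apply,
    HomologicalComplex.toCycles_comp_homologyπ]
  · rfl
  · rw [← ConcreteCategory.comp_apply, HomologicalComplex.toCycles_i, chainEquiv_d]
    simp

lemma Hmap_cycleClass (n : ℕ) (f : C(Y, Z)) (z : SingChain (n + 1) Y)
    (hz : singBoundary n z = 0) (hz' : singBoundary n (chainPush (n + 1) f z) = 0) :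
    Hmap (n + 1) f (cycleClass n Y ⟨z, hz⟩) = cycleClass n Z ⟨chainPush (n + 1) f z, hz'⟩ := by
  rw [cycleClass_eq n ⟨chainPush (n + 1) f z, hz'⟩
    (HomologicalComplex.cyclesMap (singularChainComplex.map (TopCat.ofHom f)) (n + 1)
      (cycleLift n Y ⟨z, hz⟩))]
  · exact ConcreteCategory.congr_hom (HomologicalComplex.homologyπ_naturality
      (singularChainComplex.map (TopCat.ofHom f)) (n + 1)) (cycleLift n Y ⟨z, hz⟩)
  · rw [← ConcreteCategory.comp_apply, HomologicalComplex.cyclesMap_i,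
      ConcreteCategory.comp_apply, chainEquiv_map, iCycles_cycleLift]

/-- Every cohomology class is represented by a singular cocycle. -/
lemma exists_cocycle_representative (n : ℕ) (u : Hco (n + 1) X) :
    ∃ c : SingChain (n + 1) X →ₗ[ℚ] ℚ,
      (∀ w, c (singBoundary (n + 1) w) = 0) ∧
      ∀ z : LinearMap.ker (singBoundary (Y := X) n), c z = u (cycleClass n X z) := by
  obtain ⟨c, hc⟩ := LinearMap.exists_extend (u ∘ₗ cycleClass n X)
  have hc' (z : LinearMap.ker (singBoundary (Y := X) n)) : c z = u (cycleClass n X z) :=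
    LinearMap.congr_fun hc z
  refine ⟨c, fun w => ?_, hc'⟩
  rw [hc' ⟨_, singBoundary_singBoundary n w⟩, cycleClass_singBoundary, map_zero]

lemma Hcomap_cycleClass {n : ℕ} {u : Hco (n + 1) X} {c : SingChain (n + 1) X →ₗ[ℚ] ℚ}
    (hc : ∀ z : LinearMap.ker (singBoundary (Y := X) n), c z = u (cycleClass n X z))
    (f : C(Y, X)) (z : SingChain (n + 1) Y) (hz : singBoundary n z = 0) :
    Hcomap (n + 1) f u (cycleClass n Y ⟨z, hz⟩) = c (chainPush (n + 1) f z) := by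
  have hz' : singBoundary n (chainPush (n + 1) f z) = 0 := by
    rw [← chainPush_singBoundary, hz, map_zero]
  rw [hc ⟨_, hz'⟩, ← Hmap_cycleClass n f z hz hz']
  rfl

/-- Two pullbacks of a cohomology class agree iff a representing cocycle takes the same values
on the images of all cycles. -/
lemma Hcomap_eq_iff {n : ℕ} {u : Hco (n + 1) X} {c : SingChain (n + 1) X →ₗ[ℚ] ℚ}
    (hc : ∀ z : LinearMap.ker (singBoundary (Y := X) n), c z = u (cycleClass n X z))
    (f g : C(Y, X)) :
    Hcomap (n + 1) f u = Hcomap (n + 1) g u ↔ ∀ z : SingChain (n + 1) Y, singBoundary n z = 0 →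
      c (chainPush (n + 1) f z) = c (chainPush (n + 1) g z) := by
  constructor
  · intro h z hz
    rw [← Hcomap_cycleClass hc f z hz, ← Hcomap_cycleClass hc g z hz, h]
  · intro h
    ext x
    obtain ⟨⟨z, hz⟩, rfl⟩ := cycleClass_surjective n x
    rw [Hcomap_cycleClass hc f z hz, Hcomap_cycleClass hc g z hz, h z hz]

lemma Hcomap_comp (n : ℕ) (f : C(Y, Z)) (g : C(Z, X)) (u : Hco n X) :
    Hcomap n f (Hcomap n g u) = Hcomap n (g.comp f) u := by
  ext x
  change u (Hmap n g (Hmap n f x)) = u (Hmap n (g.comp f) x)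
  congr 1
  exact (ConcreteCategory.congr_hom ((singularHomologyFunctor n).map_comp
    (TopCat.ofHom f) (TopCat.ofHom g)) x).symm

end

/-- The affine singular simplex in a convex set with given vertices. -/
def convexSimplex {E : Type} [AddCommGroup E] [Module ℝ E] [TopologicalSpace E]
    [ContinuousAdd E] [ContinuousSMul ℝ E] {S : Set E} (hS : Convex ℝ S) {k : ℕ}
    (v : Fin (k + 1) → S) : C(TopSimplex k, S) where
  toFun t := ⟨∑ i, t i • (v i : E), hS.sum_mem (fun i _ => t.2.1 i) t.2.2 fun i _ => (v i).2⟩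
  continuous_toFun := by
    refine Continuous.subtype_mk (continuous_finsetSum _ fun i _ => ?_) _
    exact ((continuous_apply i).comp continuous_subtype_val).smul continuous_const

/-- A space in which finitely many points span affine singular simplices, compatibly with
passing to faces and to affine subsimplices. -/
class AffinelySpanned (K : Type) [TopologicalSpace K] where
  aff : ∀ {k : ℕ}, (Fin (k + 1) → K) → C(TopSimplex k, K)
  aff_map : ∀ {k m : ℕ} (v : Fin (k + 1) → K) (i : Fin (m + 1) → Fin (k + 1)) (t : TopSimplex m),
    aff v (stdSimplex.map i t) = aff (v ∘ i) t
  aff_aff : ∀ {k m : ℕ} (v : Fin (k + 1) → K) (w : Fin (m + 1) → TopSimplex k) (t : TopSimplex m),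
    aff v (convexSimplex (convex_stdSimplex ℝ _) w t) = aff (fun i => aff v (w i)) t
  aff_vertex : ∀ {k : ℕ} (v : Fin (k + 1) → K) (i : Fin (k + 1)),
    aff v (stdSimplex.vertex i) = v i

open AffinelySpanned

lemma stdSimplex_map_apply {m k : ℕ} (i : Fin (m + 1) → Fin (k + 1)) (t : TopSimplex m)
    (j : Fin (k + 1)) : stdSimplex.map i t j = ∑ l, if i l = j then t l else 0 := by
  change FunOnFinite.linearMap ℝ ℝ i t j = _
  rw [FunOnFinite.linearMap_apply_apply, Finset.sum_filter]

/-- Convex sets are affinely spanned. -/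
abbrev AffinelySpanned.ofConvex {E : Type} [AddCommGroup E] [Module ℝ E] [TopologicalSpace E]
    [ContinuousAdd E] [ContinuousSMul ℝ E] {S : Set E} (hS : Convex ℝ S) :
    AffinelySpanned S where
  aff := convexSimplex hS
  aff_map v i t := by
    apply Subtype.ext
    simp only [convexSimplex, ContinuousMap.coe_mk, stdSimplex_map_apply, Finset.sum_smul,
      Function.comp_apply]
    rw [Finset.sum_comm]
    simp [ite_smul]
  aff_aff v w t := by
    apply Subtype.ext
    have h (j) : (convexSimplex (convex_stdSimplex ℝ _) w t) j = ∑ i, t i * w i j := by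
      change (∑ i, t i • (w i : _ → ℝ)) j = _
      simp
    change ∑ i, (convexSimplex (convex_stdSimplex ℝ _) w t) i • (v i : E) =
      ∑ i, t i • ∑ j, w i j • (v j : E)
    simp only [h, Finset.sum_smul, Finset.smul_sum, smul_smul]
    rw [Finset.sum_comm]
  aff_vertex v i := by
    apply Subtype.ext
    simp [convexSimplex]

instance (n : ℕ) : AffinelySpanned (TopSimplex n) := .ofConvex (convex_stdSimplex ℝ _)

instance : AffinelySpanned I := .ofConvex (convex_Icc 0 1)

instance {K L : Type} [TopologicalSpace K] [TopologicalSpace L] [AffinelySpanned K]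
    [AffinelySpanned L] : AffinelySpanned (K × L) where
  aff v := (aff fun i => (v i).1).prodMk (aff fun i => (v i).2)
  aff_map v i t := by ext1 <;> exact aff_map _ _ _
  aff_aff v i t := by ext1 <;> exact aff_aff _ _ _
  aff_vertex v i := by ext1 <;> exact aff_vertex _ _


lemma aff_const {K : Type} [TopologicalSpace K] [AffinelySpanned K] {k : ℕ} (x : K) :
    (aff fun _ : Fin (k + 1) => x) = ContinuousMap.const _ x := by
  ext1 t
  have h := aff_map (fun _ : Fin 1 => x) (fun _ : Fin (k + 1) => 0) t
  rw [Subsingleton.elim (stdSimplex.map _ t) (stdSimplex.vertex 0), aff_vertex] at h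
  exact h.symm

lemma aff_comp_faceInclusion {K : Type} [TopologicalSpace K] [AffinelySpanned K] {k : ℕ}
    (v : Fin (k + 2) → K) (i : Fin (k + 2)) :
    (aff v).comp (faceInclusion k i) = aff (v ∘ i.succAbove) := by
  ext1 t
  exact aff_map _ _ _

lemma aff_vertices (n : ℕ) :
    (aff fun i : Fin (n + 1) => (stdSimplex.vertex i : TopSimplex n)) = ContinuousMap.id _ := by
  ext t j
  change (∑ i, t i • ((stdSimplex.vertex i : TopSimplex n) : _ → ℝ)) j = t j
  simp [Pi.single_apply]

/-- Maps which carry affine simplices to affine simplices. -/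
def PreservesAff {K L : Type} [TopologicalSpace K] [AffinelySpanned K] [TopologicalSpace L]
    [AffinelySpanned L] (φ : C(K, L)) : Prop :=
  ∀ {k : ℕ} (v : Fin (k + 1) → K), φ.comp (aff v) = aff (φ ∘ v)

lemma preservesAff_aff {K : Type} [TopologicalSpace K] [AffinelySpanned K] {n : ℕ}
    (v : Fin (n + 1) → K) : PreservesAff (aff v) := by
  intro k w
  ext1 t
  exact aff_aff v w t

lemma preservesAff_id {K : Type} [TopologicalSpace K] [AffinelySpanned K] :
    PreservesAff (ContinuousMap.id K) := fun _ => rfl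

lemma PreservesAff.prodMap {K L K' L' : Type} [TopologicalSpace K] [AffinelySpanned K]
    [TopologicalSpace L] [AffinelySpanned L] [TopologicalSpace K'] [AffinelySpanned K']
    [TopologicalSpace L'] [AffinelySpanned L'] {φ : C(K, L)} {φ' : C(K', L')}
    (h : PreservesAff φ) (h' : PreservesAff φ') : PreservesAff (φ.prodMap φ') := by
  intro k v
  ext1 t
  exact Prod.ext (DFunLike.congr_fun (h fun i => (v i).1) t)
    (DFunLike.congr_fun (h' fun i => (v i).2) t)

/-- The value of a one-dimensional cochain on the image of an affine segment. -/
def ev₁ {X K : Type} [TopologicalSpace X] [TopologicalSpace K] [AffinelySpanned K]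
    (c : C(TopSimplex 1, X) → ℚ) (g : C(K, X)) (p q : K) : ℚ :=
  c (g.comp (aff ![p, q]))

/-- The value of a two-dimensional cochain on the image of an affine triangle. -/
def ev₂ {X K : Type} [TopologicalSpace X] [TopologicalSpace K] [AffinelySpanned K]
    (c : C(TopSimplex 2, X) → ℚ) (g : C(K, X)) (p q r : K) : ℚ :=
  c (g.comp (aff ![p, q, r]))

/-- One-dimensional singular cocycles, as functions on singular simplices. -/
def IsCocycle₁ {X : Type} [TopologicalSpace X] (c : C(TopSimplex 1, X) → ℚ) : Prop :=
  ∀ τ : C(TopSimplex 2, X), c (τ.comp (faceInclusion 1 0)) - c (τ.comp (faceInclusion 1 1)) +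
    c (τ.comp (faceInclusion 1 2)) = 0

/-- Two-dimensional singular cocycles, as functions on singular simplices. -/
def IsCocycle₂ {X : Type} [TopologicalSpace X] (c : C(TopSimplex 2, X) → ℚ) : Prop :=
  ∀ τ : C(TopSimplex 3, X), c (τ.comp (faceInclusion 2 0)) - c (τ.comp (faceInclusion 2 1)) +
    c (τ.comp (faceInclusion 2 2)) - c (τ.comp (faceInclusion 2 3)) = 0

section

variable {X Y K L : Type} [TopologicalSpace X] [TopologicalSpace Y] [TopologicalSpace K]
  [AffinelySpanned K] [TopologicalSpace L] [AffinelySpanned L]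

lemma comp_aff₂_face (g : C(K, X)) (p q r : K) :
    (g.comp (aff ![p, q, r])).comp (faceInclusion 1 0) = g.comp (aff ![q, r]) ∧
    (g.comp (aff ![p, q, r])).comp (faceInclusion 1 1) = g.comp (aff ![p, r]) ∧
    (g.comp (aff ![p, q, r])).comp (faceInclusion 1 2) = g.comp (aff ![p, q]) := by
  simp only [ContinuousMap.comp_assoc, aff_comp_faceInclusion]
  refine ⟨?_, ?_, ?_⟩ <;> congr 2 <;> ext j <;> fin_cases j <;> rfl

lemma IsCocycle₁.ev₁_eq {c : C(TopSimplex 1, X) → ℚ} (hc : IsCocycle₁ c) (g : C(K, X))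
    (p q r : K) : ev₁ c g q r - ev₁ c g p r + ev₁ c g p q = 0 := by
  have h := hc (g.comp (aff ![p, q, r]))
  obtain ⟨h0, h1, h2⟩ := comp_aff₂_face g p q r
  rwa [h0, h1, h2] at h

lemma IsCocycle₂.ev₂_eq {c : C(TopSimplex 2, X) → ℚ} (hc : IsCocycle₂ c) (g : C(K, X))
    (p q r s : K) : ev₂ c g q r s - ev₂ c g p r s + ev₂ c g p q s - ev₂ c g p q r = 0 := by
  have h := hc (g.comp (aff ![p, q, r, s]))
  simp only [ContinuousMap.comp_assoc, aff_comp_faceInclusion] at h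
  convert h using 4 <;> unfold ev₂ <;> congr 3 <;> ext j <;> fin_cases j <;> rfl

lemma ev₁_comp (c : C(TopSimplex 1, X) → ℚ) (g : C(L, X)) {φ : C(K, L)} (hφ : PreservesAff φ)
    (p q : K) : ev₁ c (g.comp φ) p q = ev₁ c g (φ p) (φ q) := by
  simp only [ev₁, ContinuousMap.comp_assoc, hφ ![p, q]]
  congr 3; ext j; fin_cases j <;> rfl

lemma ev₂_comp (c : C(TopSimplex 2, X) → ℚ) (g : C(L, X)) {φ : C(K, L)} (hφ : PreservesAff φ)
    (p q r : K) : ev₂ c (g.comp φ) p q r = ev₂ c g (φ p) (φ q) (φ r) := by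
  simp only [ev₂, ContinuousMap.comp_assoc, hφ ![p, q, r]]
  congr 3; ext j; fin_cases j <;> rfl

lemma aff_vertices₂ : (aff ![stdSimplex.vertex 0, stdSimplex.vertex 1, stdSimplex.vertex 2] :
    C(TopSimplex 2, TopSimplex 2)) = ContinuousMap.id _ := by
  rw [← aff_vertices]
  congr 1; ext j; fin_cases j <;> rfl

lemma ev₂_vertices (c : C(TopSimplex 2, X) → ℚ) (τ : C(TopSimplex 2, X)) :
    ev₂ c τ (stdSimplex.vertex 0) (stdSimplex.vertex 1) (stdSimplex.vertex 2) = c τ := by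
  rw [ev₂, aff_vertices₂, ContinuousMap.comp_id]

lemma face_eq_comp_aff (τ : C(TopSimplex 2, X)) :
    τ.comp (faceInclusion 1 0) = τ.comp (aff ![stdSimplex.vertex 1, stdSimplex.vertex 2]) ∧
    τ.comp (faceInclusion 1 1) = τ.comp (aff ![stdSimplex.vertex 0, stdSimplex.vertex 2]) ∧
    τ.comp (faceInclusion 1 2) = τ.comp (aff ![stdSimplex.vertex 0, stdSimplex.vertex 1]) := by
  have h := comp_aff₂_face τ (stdSimplex.vertex 0) (stdSimplex.vertex 1) (stdSimplex.vertex 2)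
  rwa [aff_vertices₂, ContinuousMap.comp_id] at h

end

section

variable {X K L : Type} [TopologicalSpace X] [TopologicalSpace K]
  [AffinelySpanned K] [TopologicalSpace L] [AffinelySpanned L]

/-- The value of a cochain on the affine square spanned by a segment in `K` and one in `I`. -/
def squareEval (c : C(TopSimplex 2, X) → ℚ) (h : C(K × I, X)) (p q : K) (s t : I) : ℚ :=
  ev₂ c h (p, s) (p, t) (q, t) - ev₂ c h (p, s) (q, s) (q, t)

lemma squareEval_comp (c : C(TopSimplex 2, X) → ℚ) (h : C(L × I, X)) {φ : C(K, L)}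
    {ψ : C(I, I)} (hφ : PreservesAff φ) (hψ : PreservesAff ψ) (p q : K) (s t : I) :
    squareEval c (h.comp (φ.prodMap ψ)) p q s t =
      squareEval c h (φ p) (φ q) (ψ s) (ψ t) := by
  simp only [squareEval, ev₂_comp c h (hφ.prodMap hψ)]
  rfl

/-- The prism identity. -/
lemma squareEval_prism {c : C(TopSimplex 2, X) → ℚ} (hc : IsCocycle₂ c) (h : C(K × I, X))
    (p q r : K) (s t : I) :
    squareEval c h q r s t - squareEval c h p r s t + squareEval c h p q s t =
      ev₂ c h (p, t) (q, t) (r, t) - ev₂ c h (p, s) (q, s) (r, s) := by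
  have h1 := hc.ev₂_eq h (p, s) (p, t) (q, t) (r, t)
  have h2 := hc.ev₂_eq h (p, s) (q, s) (q, t) (r, t)
  have h3 := hc.ev₂_eq h (p, s) (q, s) (r, s) (r, t)
  simp only [squareEval]
  linarith

lemma squareEval_vertical {c : C(TopSimplex 2, X) → ℚ} (hc : IsCocycle₂ c) (h : C(K × I, X))
    (p q : K) (r s t : I) :
    squareEval c h p q r s + squareEval c h p q s t - squareEval c h p q r t =
      ev₂ c h (p, r) (p, s) (p, t) - ev₂ c h (q, r) (q, s) (q, t) := by
  have h1 := hc.ev₂_eq h (p, r) (p, s) (p, t) (q, t)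
  have h2 := hc.ev₂_eq h (p, r) (p, s) (q, s) (q, t)
  have h3 := hc.ev₂_eq h (p, r) (q, r) (q, s) (q, t)
  simp only [squareEval]
  linarith

lemma ev₂_vertical (c : C(TopSimplex 2, X) → ℚ) (h : C(K × I, X)) {p q : K}
    (hpq : ∀ t, h (p, t) = h (q, t)) (r s t : I) :
    ev₂ c h (p, r) (p, s) (p, t) = ev₂ c h (q, r) (q, s) (q, t) := by
  have key (p : K) : (aff ![(p, r), (p, s), (p, t)] : C(TopSimplex 2, K × I)) =
      (ContinuousMap.const _ p).prodMk (aff ![r, s, t]) := by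
    rw [← aff_const]
    ext1 x
    refine Prod.ext (congrArg (fun v : Fin 3 → K => aff v x) (funext fun j => ?_))
      (congrArg (fun v : Fin 3 → I => aff v x) (funext fun j => ?_)) <;> fin_cases j <;> rfl
  unfold ev₂
  rw [key, key]
  congr 1
  ext x
  exact hpq _

end

lemma preservesAff_unitInterval {φ : C(I, I)} (a b : ℝ) (h : ∀ t, (φ t : ℝ) = a * t + b) :
    PreservesAff φ := by
  intro k v
  ext x
  have hx : ∑ i, x i = 1 := x.2.2
  change (φ (⟨∑ i, x i • (v i : ℝ), _⟩ : I) : ℝ) = ∑ i, x i • (φ (v i) : ℝ)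
  rw [h]
  simp only [h, smul_eq_mul, mul_add, Finset.sum_add_distrib, ← Finset.sum_mul, hx, Finset.mul_sum]
  rw [one_mul]
  congr 1
  exact Finset.sum_congr rfl fun i _ => by ring

/-- The affine self-map of the interval from `0` to `1 / 2`. -/
def halfMap : C(I, I) := ⟨fun t => ⟨t / 2, by constructor <;> linarith [t.2.1, t.2.2]⟩, by fun_prop⟩

/-- The affine self-map of the interval from `1` to `1 / 2`. -/
def coHalfMap : C(I, I) :=
  ⟨fun t => ⟨1 - t / 2, by constructor <;> linarith [t.2.1, t.2.2]⟩, by fun_prop⟩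

lemma preservesAff_halfMap : PreservesAff halfMap :=
  preservesAff_unitInterval (1 / 2) 0 fun t => by simp [halfMap]; ring

lemma preservesAff_coHalfMap : PreservesAff coHalfMap :=
  preservesAff_unitInterval (-1 / 2) 1 fun t => by simp [coHalfMap]; ring

/-- Gluing of two homotopies with the same ends. -/
lemma exists_glue {K X : Type} [TopologicalSpace K] [TopologicalSpace X] (g h : C(K × I, X))
    (h₁ : ∀ s, g (s, 1) = h (s, 1)) :
    ∃ F : C(K × I, X), F.comp ((ContinuousMap.id K).prodMap halfMap) = g ∧
      F.comp ((ContinuousMap.id K).prodMap coHalfMap) = h := by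
  let F : K × I → X := fun x => if (x.2 : ℝ) ≤ 1 / 2 then
    g (x.1, Set.projIcc 0 1 zero_le_one (2 * (x.2 : ℝ)))
    else h (x.1, Set.projIcc 0 1 zero_le_one (2 - 2 * (x.2 : ℝ)))
  have hF : Continuous F := by
    refine Continuous.if_le ?_ ?_ (by fun_prop) continuous_const ?_
    · exact g.continuous.comp (by fun_prop)
    · exact h.continuous.comp (by fun_prop)
    · intro x hx
      rw [hx]
      convert h₁ x.1 using 3 <;> norm_num
  refine ⟨⟨F, hF⟩, ?_, ?_⟩
  · ext ⟨s, t⟩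
    have : (t : ℝ) / 2 ≤ 1 / 2 := by linarith [t.2.2]
    simp only [F, halfMap, ContinuousMap.comp_apply, ContinuousMap.prodMap_apply,
      ContinuousMap.coe_mk, Prod.map, ContinuousMap.id_apply, if_pos this]
    congr 2
    rw [mul_div_cancel₀ _ two_ne_zero]
    exact Set.projIcc_val zero_le_one t
  · ext ⟨s, t⟩
    simp only [F, coHalfMap, ContinuousMap.comp_apply, ContinuousMap.prodMap_apply,
      ContinuousMap.coe_mk, Prod.map, ContinuousMap.id_apply]
    have e : (2 : ℝ) - 2 * (1 - t / 2) = t := by ring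
    rw [e]
    split_ifs with H
    · have : t = 1 := Subtype.ext (by show (t:ℝ) = 1; linarith [t.2.2])
      subst this
      convert h₁ s using 3
      norm_num
    · congr 2
      exact Set.projIcc_val zero_le_one t

/-- If a cocycle vanishes on all doubly periodic squares, then homotopies between the same
ends which are parametrised by a loop have equal square evaluations. -/
lemma squareEval_eq_of_periodic {X : Type} [TopologicalSpace X] {c : C(TopSimplex 2, X) → ℚ}
    (hc : IsCocycle₂ c)
    (hT : ∀ F : C(I × I, X), (∀ s, F (s, 0) = F (s, 1)) → (∀ t, F (0, t) = F (1, t)) →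
      squareEval c F 0 1 0 1 = 0)
    (g h : C(I × I, X)) (h₀ : ∀ s, g (s, 0) = h (s, 0)) (h₁ : ∀ s, g (s, 1) = h (s, 1))
    (hg : ∀ t, g (0, t) = g (1, t)) (hh : ∀ t, h (0, t) = h (1, t)) :
    squareEval c g 0 1 0 1 = squareEval c h 0 1 0 1 := by
  obtain ⟨F, rfl, rfl⟩ := exists_glue g h h₁
  have e0 : halfMap 0 = 0 := by ext; simp [halfMap]
  have e1 : coHalfMap 0 = 1 := by ext; simp [coHalfMap]
  have e2 : coHalfMap 1 = halfMap 1 := by ext; simp [coHalfMap, halfMap]; norm_num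
  have hF (t : I) : F (0, t) = F (1, t) := by
    rcases le_total (t : ℝ) (1 / 2) with ht | ht
    · have := hg ⟨2 * t, by constructor <;> linarith [t.2.1]⟩
      simpa [halfMap] using this
    · have := hh ⟨2 - 2 * t, by constructor <;> linarith [t.2.2]⟩
      simpa [coHalfMap, sub_div] using this
  have hF' (s : I) : F (s, 0) = F (s, 1) := by
    have := h₀ s
    simpa [e0, e1] using this
  rw [squareEval_comp _ _ preservesAff_id preservesAff_halfMap,
    squareEval_comp _ _ preservesAff_id preservesAff_coHalfMap, e0, e1, e2]
  simp only [ContinuousMap.id_apply]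
  have k1 := squareEval_vertical hc F 0 1 0 (halfMap 1) 1
  have k2 := squareEval_vertical hc F 0 1 (halfMap 1) 1 (halfMap 1)
  have k3 := squareEval_vertical hc F 0 1 (halfMap 1) (halfMap 1) (halfMap 1)
  have k4 := squareEval_vertical hc F 0 1 1 (halfMap 1) 1
  have k5 := squareEval_vertical hc F 0 1 1 1 1
  rw [ev₂_vertical c F hF, sub_self] at k1 k2 k3 k4 k5
  have k6 := hT F hF' hF
  linarith

/-- The parametrisation `t ↦ (cos 2πt, sin 2πt)` of the circle. -/
def circleParam : C(I, unitSphere 1) where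
  toFun t := ⟨!₂[Real.cos (2 * Real.pi * t), Real.sin (2 * Real.pi * t)], by
    simp [EuclideanSpace.norm_eq]⟩
  continuous_toFun := by
    refine Continuous.subtype_mk ((PiLp.continuous_toLp 2 _).comp (continuous_pi fun i => ?_)) _
    fin_cases i
    · exact (by fun_prop : Continuous fun t : I => Real.cos (2 * Real.pi * t))
    · exact (by fun_prop : Continuous fun t : I => Real.sin (2 * Real.pi * t))

lemma circleParam_surjective : Function.Surjective circleParam := by
  intro x
  have hx : (x : EuclideanSpace ℝ (Fin 2)) 0 ^ 2 + (x : EuclideanSpace ℝ (Fin 2)) 1 ^ 2 = 1 := by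
    have := x.2
    rw [mem_sphere_zero_iff_norm, EuclideanSpace.norm_eq, Real.sqrt_eq_one] at this
    simpa using this
  set z : ℂ := ⟨(x : EuclideanSpace ℝ (Fin 2)) 0, (x : EuclideanSpace ℝ (Fin 2)) 1⟩ with hz
  have hn : ‖z‖ = 1 := by
    rw [Complex.norm_def, Complex.normSq_apply, Real.sqrt_eq_one]
    simp only [hz]; linarith
  have hz0 : z ≠ 0 := by rintro h; simp [h] at hn
  have hc : Real.cos z.arg = z.re := by rw [Complex.cos_arg hz0, hn, div_one]
  have hs : Real.sin z.arg = z.im := by rw [Complex.sin_arg, hn, div_one]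
  have hpi := Real.pi_pos
  have h1 := Complex.neg_pi_lt_arg z
  have h2 := Complex.arg_le_pi z
  obtain ⟨θ, h3, h4, h5, h6⟩ : ∃ θ : ℝ, 0 ≤ θ ∧ θ ≤ 2 * Real.pi ∧ Real.cos θ = z.re ∧
      Real.sin θ = z.im := by
    rcases le_total 0 z.arg with h | h
    · exact ⟨z.arg, h, by linarith, hc, hs⟩
    · exact ⟨z.arg + 2 * Real.pi, by linarith, by linarith, by simpa using hc, by simpa using hs⟩
  refine ⟨⟨θ / (2 * Real.pi), by positivity, by rw [div_le_one (by positivity)]; exact h4⟩, ?_⟩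
  have e : 2 * Real.pi * (θ / (2 * Real.pi)) = θ := by field_simp
  apply Subtype.ext
  ext i
  fin_cases i
  · simp [circleParam, e, h5, hz]
  · simp [circleParam, e, h6, hz]

lemma circleParam_eq {s t : I} (h : circleParam s = circleParam t) :
    s = t ∨ (s = 0 ∧ t = 1) ∨ (s = 1 ∧ t = 0) := by
  have h0 : Real.cos (2 * Real.pi * s) = Real.cos (2 * Real.pi * t) :=
    congrArg (fun x : unitSphere 1 => (x : EuclideanSpace ℝ (Fin 2)) 0) h
  have h1 : Real.sin (2 * Real.pi * s) = Real.sin (2 * Real.pi * t) :=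
    congrArg (fun x : unitSphere 1 => (x : EuclideanSpace ℝ (Fin 2)) 1) h
  have h2 := Real.Angle.cos_sin_inj h0 h1
  rw [Real.Angle.angle_eq_iff_two_pi_dvd_sub] at h2
  obtain ⟨k, hk⟩ := h2
  have hk' : (s : ℝ) - t = k := by
    have : 2 * Real.pi ≠ 0 := by positivity
    apply mul_left_cancel₀ this
    linarith
  have b1 : (k : ℝ) ≤ 1 := by linarith [s.2.2, t.2.1]
  have b2 : (-1 : ℝ) ≤ k := by linarith [s.2.1, t.2.2]
  have b1' : k ≤ 1 := by exact_mod_cast b1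
  have b2' : -1 ≤ k := by exact_mod_cast b2
  obtain rfl | rfl | rfl : k = -1 ∨ k = 0 ∨ k = 1 := by omega
  · right; left
    push_cast at hk'
    constructor <;> apply Subtype.ext <;> simp only [Set.Icc.coe_zero, Set.Icc.coe_one] <;>
      linarith [s.2.1, t.2.2]
  · left
    push_cast at hk'
    exact Subtype.ext (by linarith)
  · right; right
    push_cast at hk'
    constructor <;> apply Subtype.ext <;> simp only [Set.Icc.coe_zero, Set.Icc.coe_one] <;>
      linarith [s.2.2, t.2.1]

/-- Doubly periodic squares factor through the torus. -/
lemma exists_torus_factorization {X : Type} [TopologicalSpace X] (F : C(I × I, X))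
    (h₁ : ∀ s, F (s, 0) = F (s, 1)) (h₂ : ∀ t, F (0, t) = F (1, t)) :
    ∃ f : C(Torus2, X), f.comp (circleParam.prodMap circleParam) = F := by
  have hq : IsQuotientMap (circleParam.prodMap circleParam) :=
    (circleParam.prodMap circleParam).continuous.isClosedMap.isQuotientMap
      (circleParam.prodMap circleParam).continuous
      (circleParam_surjective.prodMap circleParam_surjective)
  refine ⟨hq.lift F ?_, hq.lift_comp F _⟩
  rintro ⟨s, t⟩ ⟨s', t'⟩ h
  have e1 : circleParam s = circleParam s' := congrArg Prod.fst h
  have e2 : circleParam t = circleParam t' := congrArg Prod.snd h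
  have k1 (t : I) : F (s, t) = F (s', t) := by
    rcases circleParam_eq e1 with rfl | ⟨rfl, rfl⟩ | ⟨rfl, rfl⟩
    · rfl
    · exact h₂ t
    · exact (h₂ t).symm
  rw [k1]
  rcases circleParam_eq e2 with rfl | ⟨rfl, rfl⟩ | ⟨rfl, rfl⟩
  · rfl
  · exact h₁ s'
  · exact (h₁ s').symm

lemma singBoundary_one {Y : Type} [TopologicalSpace Y] (τ : C(TopSimplex 2, Y)) :
    singBoundary 1 (Finsupp.single τ 1) = Finsupp.single (τ.comp (faceInclusion 1 0)) 1 -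
      Finsupp.single (τ.comp (faceInclusion 1 1)) 1 +
      Finsupp.single (τ.comp (faceInclusion 1 2)) (1 : ℚ) := by
  rw [singBoundary_single, one_smul, Fin.sum_univ_three]
  simp [sub_eq_add_neg]

lemma aff_pair_self {K : Type} [TopologicalSpace K] [AffinelySpanned K] (p : K)
    (x : TopSimplex 1) : aff ![p, p] x = p := by
  have h := DFunLike.congr_fun (aff_const (k := 1) p) x
  rwa [show (fun _ : Fin 2 => p) = ![p, p] by ext j; fin_cases j <;> rfl] at h

lemma aff_prod_pair_apply {K L : Type} [TopologicalSpace K] [AffinelySpanned K]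
    [TopologicalSpace L] [AffinelySpanned L] (p q : K × L) (x : TopSimplex 1) :
    aff ![p, q] x = (aff ![p.1, q.1] x, aff ![p.2, q.2] x) := by
  refine Prod.ext (congrArg (fun v : Fin 2 → K => aff v x) (funext fun j => ?_))
    (congrArg (fun v : Fin 2 → L => aff v x) (funext fun j => ?_)) <;> fin_cases j <;> rfl

/-- A cocycle whose class is atoroidal vanishes on doubly periodic squares. -/
lemma squareEval_eq_zero_of_atoroidal {X : Type} [TopologicalSpace X] {u : Hco 2 X}
    (hu : ∀ f : C(Torus2, X), Hcomap 2 f u = 0) {c : SingChain 2 X →ₗ[ℚ] ℚ}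
    (hc : ∀ z : LinearMap.ker (singBoundary (Y := X) 1), c z = u (cycleClass 1 X z))
    (F : C(I × I, X)) (h₁ : ∀ s, F (s, 0) = F (s, 1)) (h₂ : ∀ t, F (0, t) = F (1, t)) :
    squareEval (fun τ => c (Finsupp.single τ 1)) F 0 1 0 1 = 0 := by
  obtain ⟨f, rfl⟩ := exists_torus_factorization F h₁ h₂
  set q := circleParam.prodMap circleParam
  have e01 : circleParam 0 = circleParam 1 := by
    apply Subtype.ext; ext i; fin_cases i <;> simp [circleParam]
  let z : SingChain 2 Torus2 :=
    Finsupp.single (q.comp (aff ![((0 : I), (0 : I)), (0, 1), (1, 1)])) 1 -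
      Finsupp.single (q.comp (aff ![((0 : I), (0 : I)), (1, 0), (1, 1)])) 1
  have hz : singBoundary 1 z = 0 := by
    have hv : q.comp (aff ![((0 : I), (0 : I)), (0, 1)]) =
        q.comp (aff ![((1 : I), (0 : I)), (1, 1)]) := by
      ext1 x
      simp only [ContinuousMap.comp_apply, aff_prod_pair_apply, aff_pair_self]
      exact Prod.ext e01 rfl
    have hh : q.comp (aff ![((0 : I), (0 : I)), (1, 0)]) =
        q.comp (aff ![((0 : I), (1 : I)), (1, 1)]) := by
      ext1 x
      simp only [ContinuousMap.comp_apply, aff_prod_pair_apply, aff_pair_self]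
      exact Prod.ext rfl e01
    simp only [z, map_sub, singBoundary_one, comp_aff₂_face, hv, hh]
    abel
  have := Hcomap_cycleClass hc f z hz
  rw [hu f] at this
  simp only [z, map_sub, chainPush_single, LinearMap.zero_apply] at this
  exact this.symm

lemma preservesAff_prodMk_const {K L : Type} [TopologicalSpace K] [AffinelySpanned K]
    [TopologicalSpace L] [AffinelySpanned L] (y : L) :
    PreservesAff ((ContinuousMap.id K).prodMk (ContinuousMap.const K y)) := by
  intro k v
  ext1 x
  exact Prod.ext rfl (DFunLike.congr_fun (aff_const (k := k) y) x).symm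

section

variable {X W Y : Type} [TopologicalSpace X] [TopologicalSpace W] [TopologicalSpace Y]

/-- The one-dimensional cochain obtained by integrating a two-dimensional cochain along a
homotopy. -/
def homotopyCochain (c : C(TopSimplex 2, X) → ℚ) (G : C(W × I, X)) (e : C(TopSimplex 1, W)) : ℚ :=
  squareEval c (G.comp (e.prodMap (ContinuousMap.id I))) (stdSimplex.vertex 0)
    (stdSimplex.vertex 1) 0 1

/-- The time-`t` map of a homotopy. -/
abbrev atTime (G : C(W × I, X)) (t : I) : C(W, X) :=
  G.comp ((ContinuousMap.id W).prodMk (ContinuousMap.const W t))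

lemma homotopyCochain_comp_aff {K : Type} [TopologicalSpace K] [AffinelySpanned K]
    (c : C(TopSimplex 2, X) → ℚ) (G : C(W × I, X)) (g : C(K, W)) (p q : K) :
    homotopyCochain c G (g.comp (aff ![p, q])) =
      squareEval c (G.comp (g.prodMap (ContinuousMap.id I))) p q 0 1 := by
  have h := squareEval_comp c (G.comp (g.prodMap (ContinuousMap.id I)))
    (preservesAff_aff ![p, q]) preservesAff_id (stdSimplex.vertex 0) (stdSimplex.vertex 1) 0 1
  rw [aff_vertex, aff_vertex] at h
  exact h

lemma homotopyCochain_coboundary {c : C(TopSimplex 2, X) → ℚ} (hc : IsCocycle₂ c)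
    (G : C(W × I, X)) (τ : C(TopSimplex 2, W)) :
    homotopyCochain c G (τ.comp (faceInclusion 1 0)) -
      homotopyCochain c G (τ.comp (faceInclusion 1 1)) +
      homotopyCochain c G (τ.comp (faceInclusion 1 2)) =
    c ((atTime G 1).comp τ) - c ((atTime G 0).comp τ) := by
  obtain ⟨h0, h1, h2⟩ := face_eq_comp_aff τ
  rw [h0, h1, h2]
  simp only [homotopyCochain_comp_aff]
  rw [squareEval_prism hc]
  have key (t : I) (p q r : TopSimplex 2) :
      ev₂ c (G.comp (τ.prodMap (ContinuousMap.id I))) (p, t) (q, t) (r, t) =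
        ev₂ c ((atTime G t).comp τ) p q r :=
    (ev₂_comp c _ (preservesAff_prodMk_const t) p q r).symm
  rw [key, key, ev₂_vertices, ev₂_vertices]

/-- A one-dimensional cocycle vanishing on loops is the coboundary of a function. -/
lemma IsCocycle₁.exists_potential {φ : C(TopSimplex 1, W) → ℚ} (hφ : IsCocycle₁ φ)
    (hl : ∀ l : C(I, W), l 0 = l 1 → ev₁ φ l 0 1 = 0) :
    ∃ ψ : W → ℚ, ∀ e, φ e = ψ (e (stdSimplex.vertex 1)) - ψ (e (stdSimplex.vertex 0)) := by
  have htrans {x y z : W} (p : Path x y) (q : Path y z) :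
      ev₁ φ (p.trans q : C(I, W)) 0 1 = ev₁ φ (p : C(I, W)) 0 1 + ev₁ φ (q : C(I, W)) 0 1 := by
    let r : C(I, I) :=
      ⟨fun t => ⟨(t + 1) / 2, by constructor <;> linarith [t.2.1, t.2.2]⟩, by fun_prop⟩
    have hr : PreservesAff r := preservesAff_unitInterval (1 / 2) (1 / 2) fun t => by
      simp only [r, ContinuousMap.coe_mk]; ring
    have ep : (p : C(I, W)) = (p.trans q : C(I, W)).comp halfMap := by
      ext t
      have ht : (halfMap t : ℝ) ≤ 1 / 2 := by
        change (t : ℝ) / 2 ≤ 1 / 2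
        linarith [t.2.2]
      change p t = (p.trans q) (halfMap t)
      rw [Path.trans_apply, dif_pos ht]
      congr 1
      ext
      simp only [halfMap, ContinuousMap.coe_mk]
      ring
    have eq : (q : C(I, W)) = (p.trans q : C(I, W)).comp r := by
      ext t
      change q t = (p.trans q) (r t)
      rw [Path.trans_apply]
      split_ifs with ht
      · have h0 : t = 0 := Subtype.ext (by
          simp only [r, ContinuousMap.coe_mk] at ht; change (t : ℝ) = 0; linarith [t.2.1])
        subst h0
        simp [r]
      · congr 1
        ext
        simp only [r, ContinuousMap.coe_mk]
        ring
    rw [ep, eq, ev₁_comp _ _ preservesAff_halfMap, ev₁_comp _ _ hr]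
    have e0 : halfMap 0 = 0 := by ext; simp [halfMap]
    have e1 : halfMap 1 = r 0 := by ext; simp [halfMap, r]
    have e2 : r 1 = 1 := by ext; simp [r]
    rw [e0, e1, e2]
    have := hφ.ev₁_eq (p.trans q : C(I, W)) 0 (r 0) 1
    linarith
  have hsymm {x y : W} (p : Path x y) :
      ev₁ φ (p.symm : C(I, W)) 0 1 = - ev₁ φ (p : C(I, W)) 0 1 := by
    let r : C(I, I) := ⟨symm, continuous_symm⟩
    have hr : PreservesAff r := preservesAff_unitInterval (-1) 1 fun t => by
      simp only [r, ContinuousMap.coe_mk, coe_symm_eq]; ring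
    have ep : (p.symm : C(I, W)) = (p : C(I, W)).comp r := rfl
    rw [ep, ev₁_comp _ _ hr]
    have e0 : r 0 = 1 := by simp [r]
    have e1 : r 1 = 0 := by simp [r]
    rw [e0, e1]
    have h1 := hφ.ev₁_eq (p : C(I, W)) 0 1 0
    have h2 := hφ.ev₁_eq (p : C(I, W)) 0 0 0
    linarith
  have heq {x y : W} (p q : Path x y) : ev₁ φ (p : C(I, W)) 0 1 = ev₁ φ (q : C(I, W)) 0 1 := by
    have := hl (p.trans q.symm : C(I, W)) (by simp)
    rw [htrans, hsymm] at this
    linarith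
  have hj (w : W) : Joined (Quotient.out (Quotient.mk (pathSetoid W) w)) w :=
    Quotient.mk_out (s := pathSetoid W) w
  refine ⟨fun w => ev₁ φ ((hj w).somePath : C(I, W)) 0 1, fun e => ?_⟩
  let m : C(I, TopSimplex 1) := ⟨stdSimplexHomeomorphUnitInterval.symm, by fun_prop⟩
  have m0 : m 0 = stdSimplex.vertex 0 := by
    refine stdSimplexHomeomorphUnitInterval.symm_apply_eq.2 (Subtype.ext ?_)
    change (0 : ℝ) = (stdSimplex.vertex 0 : TopSimplex 1) 1
    simp
  have m1 : m 1 = stdSimplex.vertex 1 := by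
    refine stdSimplexHomeomorphUnitInterval.symm_apply_eq.2 (Subtype.ext ?_)
    change (1 : ℝ) = (stdSimplex.vertex 1 : TopSimplex 1) 1
    simp
  let p : Path (e (stdSimplex.vertex 0)) (e (stdSimplex.vertex 1)) :=
    ⟨e.comp m, by simp [m0], by simp [m1]⟩
  have hm : m.comp (aff ![0, 1]) = ContinuousMap.id _ := by
    ext1 x
    refine stdSimplexHomeomorphUnitInterval.symm_apply_eq.2 (Subtype.ext ?_)
    change ∑ i, x i • ((![(0 : I), 1] i : I) : ℝ) = x 1
    simp [Fin.sum_univ_two]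
  have he : φ e = ev₁ φ (p : C(I, W)) 0 1 := by
    change φ e = φ ((e.comp m).comp (aff ![0, 1]))
    rw [ContinuousMap.comp_assoc, hm, ContinuousMap.comp_id]
  have hb : Quotient.out (Quotient.mk (pathSetoid W) (e (stdSimplex.vertex 0))) =
      Quotient.out (Quotient.mk (pathSetoid W) (e (stdSimplex.vertex 1))) :=
    congrArg _ (Quotient.sound ⟨p⟩)
  have h := heq (((hj _).somePath.trans p).cast hb.symm rfl) (hj _).somePath
  have h' := htrans (hj _).somePath p
  rw [he]
  change ev₁ φ ((hj _).somePath.trans p : C(I, W)) 0 1 = _ at h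
  linarith

lemma exists_potential_of_homotopies {c : C(TopSimplex 2, X) → ℚ} (hc : IsCocycle₂ c)
    (hT : ∀ F : C(I × I, X), (∀ s, F (s, 0) = F (s, 1)) → (∀ t, F (0, t) = F (1, t)) →
      squareEval c F 0 1 0 1 = 0)
    (g h : C(W × I, X)) (h₀ : atTime g 0 = atTime h 0) (h₁ : atTime g 1 = atTime h 1) :
    ∃ ψ : W → ℚ, ∀ e, homotopyCochain c g e - homotopyCochain c h e =
      ψ (e (stdSimplex.vertex 1)) - ψ (e (stdSimplex.vertex 0)) := by
  refine IsCocycle₁.exists_potential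
    (φ := fun e => homotopyCochain c g e - homotopyCochain c h e) ?_ ?_
  · intro τ
    have hg := homotopyCochain_coboundary hc g τ
    have hh := homotopyCochain_coboundary hc h τ
    rw [h₀, h₁] at hg
    linarith
  · intro l hl
    have := squareEval_eq_of_periodic hc hT (g.comp (l.prodMap (ContinuousMap.id I)))
      (h.comp (l.prodMap (ContinuousMap.id I)))
      (fun s => DFunLike.congr_fun h₀ (l s)) (fun s => DFunLike.congr_fun h₁ (l s))
      (fun t => by simp [hl]) (fun t => by simp [hl])
    simp only [ev₁, homotopyCochain_comp_aff]
    linarith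

/-- Corestriction of a continuous map to a set containing its values. -/
def corestrict {K : Type} [TopologicalSpace K] (e : C(K, Y)) (U : Set Y) (h : ∀ x, e x ∈ U) :
    C(K, U) := ⟨fun x => ⟨e x, h x⟩, by fun_prop⟩

/-- If two maps are homotopic over each of two sets, then the difference of the pullbacks of a
cocycle vanishing on doubly periodic squares is a coboundary on small simplices. -/
lemma exists_small_primitive {c : C(TopSimplex 2, X) → ℚ} (hc : IsCocycle₂ c)
    (hT : ∀ F : C(I × I, X), (∀ s, F (s, 0) = F (s, 1)) → (∀ t, F (0, t) = F (1, t)) →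
      squareEval c F 0 1 0 1 = 0)
    (f₁ f₂ : C(Y, X)) {U V : Set Y} (GU : C(U × I, X)) (GV : C(V × I, X))
    (hU0 : ∀ y, GU (y, 0) = f₁ y) (hU1 : ∀ y, GU (y, 1) = f₂ y)
    (hV0 : ∀ y, GV (y, 0) = f₁ y) (hV1 : ∀ y, GV (y, 1) = f₂ y) :
    ∃ α : C(TopSimplex 1, Y) → ℚ, ∀ τ : C(TopSimplex 2, Y), (∀ x, τ x ∈ U) ∨ (∀ x, τ x ∈ V) →
      c (f₂.comp τ) - c (f₁.comp τ) = α (τ.comp (faceInclusion 1 0)) -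
        α (τ.comp (faceInclusion 1 1)) + α (τ.comp (faceInclusion 1 2)) := by
  classical
  let iU : C((U ∩ V : Set Y), U) := ⟨fun y => ⟨y, y.2.1⟩, by fun_prop⟩
  let iV : C((U ∩ V : Set Y), V) := ⟨fun y => ⟨y, y.2.2⟩, by fun_prop⟩
  obtain ⟨ψ, hψ⟩ := exists_potential_of_homotopies hc hT
    (GU.comp (iU.prodMap (ContinuousMap.id I))) (GV.comp (iV.prodMap (ContinuousMap.id I)))
    (by ext y; exact (hU0 (iU y)).trans (hV0 (iV y)).symm) (by ext y; exact (hU1 (iU y)).trans (hV1 (iV y)).symm)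
  let ψ' : Y → ℚ := fun y => if h : y ∈ U ∩ V then ψ ⟨y, h⟩ else 0
  let α : C(TopSimplex 1, Y) → ℚ := fun e =>
    if h : ∀ x, e x ∈ U then homotopyCochain c GU (corestrict e U h)
    else if h : ∀ x, e x ∈ V then homotopyCochain c GV (corestrict e V h) +
      (ψ' (e (stdSimplex.vertex 1)) - ψ' (e (stdSimplex.vertex 0))) else 0
  have hαU (e) (h : ∀ x, e x ∈ U) : α e = homotopyCochain c GU (corestrict e U h) := dif_pos h
  have hαV (e) (h : ∀ x, e x ∈ V) : α e = homotopyCochain c GV (corestrict e V h) +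
      (ψ' (e (stdSimplex.vertex 1)) - ψ' (e (stdSimplex.vertex 0))) := by
    by_cases h' : ∀ x, e x ∈ U
    · rw [hαU e h']
      have := hψ (corestrict e (U ∩ V) fun x => ⟨h' x, h x⟩)
      change homotopyCochain c GU (corestrict e U h') - homotopyCochain c GV (corestrict e V h) =
        _ at this
      simp only [ψ', dif_pos (show e (stdSimplex.vertex 1) ∈ U ∩ V from ⟨h' _, h _⟩),
        dif_pos (show e (stdSimplex.vertex 0) ∈ U ∩ V from ⟨h' _, h _⟩)]
      change _ = ψ ⟨_, _⟩ - ψ ⟨_, _⟩ at this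
      linarith
    · simp only [α, dif_neg h', dif_pos h]
  refine ⟨α, fun τ hτ => ?_⟩
  rcases hτ with h | h
  · rw [hαU _ fun _ => h _, hαU _ fun _ => h _, hαU _ fun _ => h _]
    have := homotopyCochain_coboundary hc GU (corestrict τ U h)
    rw [show (atTime GU 1).comp (corestrict τ U h) = f₂.comp τ by ext x; exact hU1 _,
      show (atTime GU 0).comp (corestrict τ U h) = f₁.comp τ by ext x; exact hU0 _] at this
    exact this.symm
  · rw [hαV _ fun _ => h _, hαV _ fun _ => h _, hαV _ fun _ => h _]
    have := homotopyCochain_coboundary hc GV (corestrict τ V h)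
    rw [show (atTime GV 1).comp (corestrict τ V h) = f₂.comp τ by ext x; exact hV1 _,
      show (atTime GV 0).comp (corestrict τ V h) = f₁.comp τ by ext x; exact hV0 _] at this
    rw [← this]
    obtain ⟨h0, h1, h2⟩ := face_eq_comp_aff τ
    have e (p q : TopSimplex 2) : ψ' ((τ.comp (aff ![p, q])) (stdSimplex.vertex 1)) -
        ψ' ((τ.comp (aff ![p, q])) (stdSimplex.vertex 0)) = ψ' (τ q) - ψ' (τ p) := by
      simp only [ContinuousMap.comp_apply, aff_vertex]; rfl
    have t0 := e (stdSimplex.vertex 1) (stdSimplex.vertex 2)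
    have t1 := e (stdSimplex.vertex 0) (stdSimplex.vertex 2)
    have t2 := e (stdSimplex.vertex 0) (stdSimplex.vertex 1)
    rw [← h0] at t0
    rw [← h1] at t1
    rw [← h2] at t2
    rw [t0, t1, t2]
    change homotopyCochain c GV (corestrict (τ.comp (faceInclusion 1 0)) V _) -
      homotopyCochain c GV (corestrict (τ.comp (faceInclusion 1 1)) V _) +
      homotopyCochain c GV (corestrict (τ.comp (faceInclusion 1 2)) V _) = _
    ring

end

/-- The midpoint of two points of an affinely spanned space. -/
def affMid {K : Type} [TopologicalSpace K] [AffinelySpanned K] (p q : K) : K :=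
  aff ![p, q] (stdSimplexHomeomorphUnitInterval.symm ⟨1 / 2, by norm_num, by norm_num⟩)

lemma PreservesAff.map_affMid {K L : Type} [TopologicalSpace K] [AffinelySpanned K]
    [TopologicalSpace L] [AffinelySpanned L] {φ : C(K, L)} (h : PreservesAff φ) (p q : K) :
    φ (affMid p q) = affMid (φ p) (φ q) := by
  have := DFunLike.congr_fun (h ![p, q])
    (stdSimplexHomeomorphUnitInterval.symm ⟨1 / 2, by norm_num, by norm_num⟩)
  refine this.trans (congrArg (fun v : Fin 2 → L => aff v _) (funext fun j => ?_))
  fin_cases j <;> rfl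

lemma coe_affMid {n : ℕ} (p q : TopSimplex n) :
    (affMid p q).val = midpoint ℝ p.val q.val := by
  set x := stdSimplexHomeomorphUnitInterval.symm ⟨1 / 2, by norm_num, by norm_num⟩ with hx
  have h1 : x 1 = 1 / 2 := rfl
  have h0 : x 0 = 1 / 2 := by change (1 : ℝ) - 1 / 2 = 1 / 2; norm_num
  change ∑ i, x i • (![p, q] i).val = _
  rw [Fin.sum_univ_two, h0, h1, midpoint_eq_smul_add, smul_add]
  simp

section

variable {Y K L : Type} [TopologicalSpace Y] [TopologicalSpace K] [AffinelySpanned K]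
  [TopologicalSpace L] [AffinelySpanned L]

/-- The image of an affine segment, as a singular chain. -/
def segChain (g : C(K, Y)) (p q : K) : SingChain 1 Y := Finsupp.single (g.comp (aff ![p, q])) 1

/-- The image of an affine triangle, as a singular chain. -/
def triChain (g : C(K, Y)) (p q r : K) : SingChain 2 Y :=
  Finsupp.single (g.comp (aff ![p, q, r])) 1

lemma segChain_comp (g : C(L, Y)) {φ : C(K, L)} (hφ : PreservesAff φ) (p q : K) :
    segChain (g.comp φ) p q = segChain g (φ p) (φ q) := by
  simp only [segChain, ContinuousMap.comp_assoc, hφ ![p, q]]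
  congr 3; ext j; fin_cases j <;> rfl

lemma triChain_comp (g : C(L, Y)) {φ : C(K, L)} (hφ : PreservesAff φ) (p q r : K) :
    triChain (g.comp φ) p q r = triChain g (φ p) (φ q) (φ r) := by
  simp only [triChain, ContinuousMap.comp_assoc, hφ ![p, q, r]]
  congr 3; ext j; fin_cases j <;> rfl

lemma singBoundary_triChain (g : C(K, Y)) (p q r : K) :
    singBoundary 1 (triChain g p q r) = segChain g q r - segChain g p r + segChain g p q := by
  obtain ⟨h0, h1, h2⟩ := comp_aff₂_face g p q r
  rw [triChain, singBoundary_one, h0, h1, h2]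
  rfl

lemma triChain_vertices (τ : C(TopSimplex 2, Y)) :
    triChain τ (stdSimplex.vertex 0) (stdSimplex.vertex 1) (stdSimplex.vertex 2) =
      Finsupp.single τ 1 := by
  rw [triChain, aff_vertices₂, ContinuousMap.comp_id]

/-- The subdivision of an affine segment. -/
def subdivSeg (g : C(K, Y)) (p q : K) : SingChain 1 Y :=
  segChain g p (affMid p q) + segChain g (affMid p q) q

/-- The subdivision of an affine triangle into four triangles. -/
def subdivTri (g : C(K, Y)) (p q r : K) : SingChain 2 Y :=
  triChain g p (affMid p q) (affMid p r) + triChain g (affMid p q) q (affMid q r) +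
    triChain g (affMid p r) (affMid q r) r - triChain g (affMid p q) (affMid p r) (affMid q r)

variable (Y) in
/-- Edgewise subdivision of singular one-chains. -/
def subdiv₁ : SingChain 1 Y →ₗ[ℚ] SingChain 1 Y :=
  Finsupp.linearCombination ℚ fun e => subdivSeg e (stdSimplex.vertex 0) (stdSimplex.vertex 1)

variable (Y) in
/-- Edgewise subdivision of singular two-chains. -/
def subdiv₂ : SingChain 2 Y →ₗ[ℚ] SingChain 2 Y :=
  Finsupp.linearCombination ℚ fun τ =>
    subdivTri τ (stdSimplex.vertex 0) (stdSimplex.vertex 1) (stdSimplex.vertex 2)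

lemma subdiv₁_segChain (g : C(K, Y)) (p q : K) :
    subdiv₁ Y (segChain g p q) = subdivSeg g p q := by
  have h : PreservesAff (aff ![p, q]) := preservesAff_aff _
  rw [subdiv₁, segChain, Finsupp.linearCombination_single, one_smul, subdivSeg,
    segChain_comp _ h, segChain_comp _ h, h.map_affMid, aff_vertex, aff_vertex]
  rfl

lemma subdiv₂_triChain (g : C(K, Y)) (p q r : K) :
    subdiv₂ Y (triChain g p q r) = subdivTri g p q r := by
  have h : PreservesAff (aff ![p, q, r]) := preservesAff_aff _
  rw [subdiv₂, triChain, Finsupp.linearCombination_single, one_smul, subdivTri]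
  simp only [triChain_comp _ h, h.map_affMid, aff_vertex]
  rfl

lemma singBoundary_subdiv₂ (z : SingChain 2 Y) :
    singBoundary 1 (subdiv₂ Y z) = subdiv₁ Y (singBoundary 1 z) := by
  induction z using Finsupp.induction_linear with
  | zero => simp
  | add x y hx hy => simp only [map_add, hx, hy]
  | single τ a =>
    rw [← mul_one a, ← smul_eq_mul, ← Finsupp.smul_single, ← triChain_vertices]
    simp only [map_smul, subdiv₂_triChain, singBoundary_triChain, map_add, map_sub,
      subdiv₁_segChain, subdivTri, subdivSeg]
    congr 1
    abel

/-- The linear extension of a function on singular simplices. -/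
abbrev cochainExt {n : ℕ} (c : C(TopSimplex n, Y) → ℚ) : SingChain n Y →ₗ[ℚ] ℚ :=
  Finsupp.linearCombination ℚ c

lemma cochainExt_triChain (c : C(TopSimplex 2, Y) → ℚ) (g : C(K, Y)) (p q r : K) :
    cochainExt c (triChain g p q r) = ev₂ c g p q r := by
  simp [triChain, ev₂]

lemma IsCocycle₂.cochainExt_subdiv₂ {c : C(TopSimplex 2, Y) → ℚ} (hc : IsCocycle₂ c)
    (z : SingChain 2 Y) (hz : singBoundary 1 z = 0) :
    cochainExt c (subdiv₂ Y z) = cochainExt c z := by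
  let B : C(TopSimplex 1, Y) → ℚ := fun e => ev₂ c e (stdSimplex.vertex 0)
    (affMid (stdSimplex.vertex 0) (stdSimplex.vertex 1)) (stdSimplex.vertex 1)
  have hB (g : C(TopSimplex 2, Y)) (p q : TopSimplex 2) :
      cochainExt B (segChain g p q) = ev₂ c g p (affMid p q) q := by
    have h : PreservesAff (aff ![p, q]) := preservesAff_aff _
    rw [segChain, Finsupp.linearCombination_single, one_smul]
    simp only [B, ev₂_comp _ _ h, h.map_affMid, aff_vertex]
    rfl
  have key (z : SingChain 2 Y) :
      cochainExt c (subdiv₂ Y z) - cochainExt c z = cochainExt B (singBoundary 1 z) := by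
    induction z using Finsupp.induction_linear with
    | zero => simp
    | add x y hx hy => simp only [map_add, ← hx, ← hy]; ring
    | single τ a =>
      rw [← mul_one a, ← smul_eq_mul, ← Finsupp.smul_single, ← triChain_vertices]
      simp only [map_smul, subdiv₂_triChain, singBoundary_triChain, map_add, map_sub,
        hB, subdivTri, cochainExt_triChain, ← smul_sub]
      congr 1
      generalize (stdSimplex.vertex 0 : TopSimplex 2) = p
      generalize (stdSimplex.vertex 1 : TopSimplex 2) = q
      generalize (stdSimplex.vertex 2 : TopSimplex 2) = r
      have h1 := hc.ev₂_eq τ p (affMid p q) q (affMid q r)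
      have h2 := hc.ev₂_eq τ p (affMid p r) (affMid q r) r
      have h3 := hc.ev₂_eq τ p (affMid p q) (affMid p r) (affMid q r)
      have h4 := hc.ev₂_eq τ p q (affMid q r) r
      linarith
  have := key z
  rw [hz, map_zero] at this
  linarith

/-- The chains supported on simplices which lie in one of two sets. -/
def smallChains (U V : Set Y) : Submodule ℚ (SingChain 2 Y) :=
  Submodule.span ℚ {w | ∃ τ : C(TopSimplex 2, Y),
    ((∀ x, τ x ∈ U) ∨ ∀ x, τ x ∈ V) ∧ w = Finsupp.single τ 1}

/-- The chains supported on affine triangles of bounded size in a given simplex. -/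
def meshChains (τ : C(TopSimplex 2, Y)) (d : ℝ) : Submodule ℚ (SingChain 2 Y) :=
  Submodule.span ℚ {w | ∃ p q r : TopSimplex 2,
    dist p q ≤ d ∧ dist p r ≤ d ∧ dist q r ≤ d ∧ w = triChain τ p q r}

lemma subdiv₂_mem_meshChains {τ : C(TopSimplex 2, Y)} {d : ℝ} {z : SingChain 2 Y}
    (hz : z ∈ meshChains τ d) : subdiv₂ Y z ∈ meshChains τ (d / 2) := by
  have : meshChains τ d ≤ (meshChains τ (d / 2)).comap (subdiv₂ Y) := by
    refine Submodule.span_le.2 ?_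
    rintro _ ⟨p, q, r, hpq, hpr, hqr, rfl⟩
    have h {p q r : TopSimplex 2} (hpq : dist p q ≤ d / 2) (hpr : dist p r ≤ d / 2)
        (hqr : dist q r ≤ d / 2) : triChain τ p q r ∈ meshChains τ (d / 2) :=
      Submodule.subset_span ⟨p, q, r, hpq, hpr, hqr, rfl⟩
    have d1 (p q : TopSimplex 2) : dist p (affMid p q) = dist p q / 2 := by
      rw [Subtype.dist_eq, coe_affMid, dist_left_midpoint, Subtype.dist_eq]; norm_num; ring
    have d2 (p q : TopSimplex 2) : dist (affMid p q) q = dist p q / 2 := by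
      rw [Subtype.dist_eq, coe_affMid, dist_midpoint_right, Subtype.dist_eq]; norm_num; ring
    have d3 (p q r : TopSimplex 2) : dist (affMid p q) (affMid p r) = dist q r / 2 := by
      rw [Subtype.dist_eq, coe_affMid, coe_affMid, Subtype.dist_eq, dist_eq_norm, dist_eq_norm,
        midpoint_eq_smul_add, midpoint_eq_smul_add, ← smul_sub, add_sub_add_left_eq_sub, norm_smul]
      norm_num; ring
    have d4 (p q r : TopSimplex 2) : dist (affMid p q) (affMid q r) = dist p r / 2 := by
      rw [Subtype.dist_eq, coe_affMid, coe_affMid, midpoint_comm, Subtype.dist_eq, dist_eq_norm,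
        dist_eq_norm, midpoint_eq_smul_add, midpoint_eq_smul_add, ← smul_sub,
        add_sub_add_left_eq_sub, norm_smul]
      norm_num; ring
    have d5 (p q r : TopSimplex 2) : dist (affMid p r) (affMid q r) = dist p q / 2 := by
      rw [Subtype.dist_eq, coe_affMid, coe_affMid, Subtype.dist_eq, dist_eq_norm,
        dist_eq_norm, midpoint_eq_smul_add, midpoint_eq_smul_add, ← smul_sub,
        add_sub_add_right_eq_sub, norm_smul]
      norm_num; ring
    change subdiv₂ Y _ ∈ meshChains τ (d / 2)
    rw [subdiv₂_triChain, subdivTri]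
    refine sub_mem (add_mem (add_mem (h ?_ ?_ ?_) (h ?_ ?_ ?_)) (h ?_ ?_ ?_)) (h ?_ ?_ ?_) <;>
      simp only [d1, d2, d3, d4, d5] <;> linarith
  exact this hz

lemma meshChains_le_smallChains {U V : Set Y} (hU : IsOpen U) (hV : IsOpen V)
    (hUV : U ∪ V = Set.univ) (τ : C(TopSimplex 2, Y)) :
    ∃ δ > 0, ∀ d < δ, meshChains τ d ≤ smallChains U V := by
  obtain ⟨δ, hδ, h⟩ := lebesgue_number_lemma_of_metric (s := (Set.univ : Set (TopSimplex 2)))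
    (c := fun b : Bool => τ ⁻¹' (if b then U else V)) isCompact_univ
    (fun b => by cases b <;> [exact hV.preimage τ.continuous; exact hU.preimage τ.continuous])
    (fun x _ => by
      rcases (hUV.symm ▸ Set.mem_univ (τ x) : τ x ∈ U ∪ V) with hx | hx
      · exact Set.mem_iUnion.2 ⟨true, hx⟩
      · exact Set.mem_iUnion.2 ⟨false, hx⟩)
  refine ⟨δ, hδ, fun d hd => Submodule.span_le.2 ?_⟩
  rintro _ ⟨p, q, r, hpq, hpr, -, rfl⟩
  have hb (x : TopSimplex 2) : (aff ![p, q, r] x : TopSimplex 2) ∈ Metric.ball p δ := by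
    have hmem := (convex_ball (p : Fin 3 → ℝ) δ).sum_mem (t := Finset.univ) (w := fun i => x i)
      (z := fun i => ((![p, q, r] i : TopSimplex 2) : Fin 3 → ℝ))
      (fun i _ => x.2.1 i) x.2.2 (fun i _ => by
        fin_cases i
        · exact Metric.mem_ball_self hδ
        · exact Metric.mem_ball'.2 (hpq.trans_lt hd)
        · exact Metric.mem_ball'.2 (hpr.trans_lt hd))
    exact hmem
  obtain ⟨b, hb'⟩ := h p (Set.mem_univ p)
  refine Submodule.subset_span ⟨_, ?_, rfl⟩
  cases b
  · exact Or.inr fun x => hb' (hb x)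
  · exact Or.inl fun x => hb' (hb x)

/-- Every chain becomes small after finitely many subdivisions. -/
lemma exists_subdiv₂_mem_smallChains {U V : Set Y} (hU : IsOpen U) (hV : IsOpen V)
    (hUV : U ∪ V = Set.univ) (z : SingChain 2 Y) :
    ∃ N, ∀ n ≥ N, (subdiv₂ Y)^[n] z ∈ smallChains U V := by
  induction z using Finsupp.induction_linear with
  | zero => exact ⟨0, fun n _ => by rw [iterate_map_zero]; exact zero_mem _⟩
  | add x y hx hy =>
    obtain ⟨N, hN⟩ := hx
    obtain ⟨M, hM⟩ := hy
    refine ⟨max N M, fun n hn => ?_⟩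
    rw [iterate_map_add]
    exact add_mem (hN n (le_of_max_le_left hn)) (hM n (le_of_max_le_right hn))
  | single τ a =>
    obtain ⟨δ, hδ, h⟩ := meshChains_le_smallChains hU hV hUV τ
    have hmem (n : ℕ) : ∃ D : ℝ, D = Metric.diam (Set.univ : Set (TopSimplex 2)) * (1 / 2) ^ n ∧
        (subdiv₂ Y)^[n] (Finsupp.single τ a) ∈ meshChains τ D := by
      induction n with
      | zero =>
        refine ⟨_, rfl, ?_⟩
        rw [show Finsupp.single τ a = a • Finsupp.single τ 1 by simp, ← triChain_vertices]
        have hd (x y : TopSimplex 2) : dist x y ≤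
            Metric.diam (Set.univ : Set (TopSimplex 2)) * (1 / 2) ^ 0 := by
          rw [pow_zero, mul_one]
          exact Metric.dist_le_diam_of_mem isCompact_univ.isBounded trivial trivial
        exact Submodule.smul_mem _ _
          (Submodule.subset_span ⟨_, _, _, hd _ _, hd _ _, hd _ _, rfl⟩)
      | succ n ih =>
        obtain ⟨D, rfl, hD⟩ := ih
        refine ⟨_, rfl, ?_⟩
        rw [Function.iterate_succ_apply']
        convert subdiv₂_mem_meshChains hD using 2
        ring
    have hlim := (tendsto_pow_atTop_nhds_zero_of_lt_one (r := (1 / 2 : ℝ)) (by norm_num)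
      (by norm_num)).const_mul (Metric.diam (Set.univ : Set (TopSimplex 2)))
    rw [mul_zero] at hlim
    obtain ⟨N, hN⟩ := Filter.eventually_atTop.1 (hlim.eventually_lt_const hδ)
    refine ⟨N, fun n hn => ?_⟩
    obtain ⟨D, rfl, hD⟩ := hmem n
    exact h _ (hN n hn) hD

/-- A cocycle which is a coboundary on small simplices vanishes on cycles. -/
lemma IsCocycle₂.eq_zero_of_small_primitive {c : C(TopSimplex 2, Y) → ℚ} (hc : IsCocycle₂ c)
    {U V : Set Y} (hU : IsOpen U) (hV : IsOpen V) (hUV : U ∪ V = Set.univ)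
    {α : C(TopSimplex 1, Y) → ℚ}
    (hα : ∀ τ : C(TopSimplex 2, Y), (∀ x, τ x ∈ U) ∨ (∀ x, τ x ∈ V) →
      c τ = α (τ.comp (faceInclusion 1 0)) -
        α (τ.comp (faceInclusion 1 1)) + α (τ.comp (faceInclusion 1 2)))
    (z : SingChain 2 Y) (hz : singBoundary 1 z = 0) : cochainExt c z = 0 := by
  obtain ⟨N, hN⟩ := exists_subdiv₂_mem_smallChains hU hV hUV z
  have hiter (n : ℕ) : singBoundary 1 ((subdiv₂ Y)^[n] z) = 0 ∧
      cochainExt c ((subdiv₂ Y)^[n] z) = cochainExt c z := by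
    induction n with
    | zero => exact ⟨hz, rfl⟩
    | succ n ih =>
      rw [Function.iterate_succ_apply', singBoundary_subdiv₂, ih.1, map_zero,
        hc.cochainExt_subdiv₂ _ ih.1]
      exact ⟨rfl, ih.2⟩
  have hsmall : smallChains U V ≤
      LinearMap.ker (cochainExt c - (cochainExt α).comp (singBoundary 1)) := by
    refine Submodule.span_le.2 ?_
    rintro _ ⟨τ, hτ, rfl⟩
    change _ = _
    simp [hα τ hτ, Fin.sum_univ_three]
    ring
  have h := hsmall (hN N le_rfl)
  rw [LinearMap.mem_ker, LinearMap.sub_apply, LinearMap.comp_apply, (hiter N).1, map_zero,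
    sub_zero, (hiter N).2] at h
  exact h

end

section

variable {X Y : Type} [TopologicalSpace X] [TopologicalSpace Y]

lemma isCocycle₂_of_linear {c : SingChain 2 X →ₗ[ℚ] ℚ} (hc : ∀ w, c (singBoundary 2 w) = 0) :
    IsCocycle₂ fun τ : C(TopSimplex 2, X) => c (Finsupp.single τ 1) := by
  intro τ
  have h := hc (Finsupp.single τ 1)
  rw [singBoundary_single, one_smul, Fin.sum_univ_four] at h
  simp only [map_add, map_smul, smul_eq_mul] at h
  rw [show ((3 : Fin 4) : ℕ) = 3 from rfl] at h
  simp only [Fin.val_zero, Fin.val_one, Fin.val_two] at h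
  linarith

lemma IsCocycle₂.comp {c : C(TopSimplex 2, X) → ℚ} (hc : IsCocycle₂ c) (f : C(Y, X)) :
    IsCocycle₂ fun τ : C(TopSimplex 2, Y) => c (f.comp τ) := fun τ => hc (f.comp τ)

lemma Hcomap_zeroDivisor_eq_zero_iff (u : Hco 2 X) (f : C(Y, X × X)) :
    Hcomap 2 f (Hcomap 2 ContinuousMap.snd u - Hcomap 2 ContinuousMap.fst u) = 0 ↔
      Hcomap 2 (ContinuousMap.snd.comp f) u = Hcomap 2 (ContinuousMap.fst.comp f) u := by
  rw [map_sub, Hcomap_comp, Hcomap_comp, sub_eq_zero]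

/-- The zero divisor of an atoroidal class pulls back to zero along maps of genus at most two. -/
theorem Hcomap_zeroDivisor_eq_zero {u : Hco 2 X} (hu : ∀ f : C(Torus2, X), Hcomap 2 f u = 0)
    (f : C(Y, X × X)) (hf : GenusPullbackLE (pathFibration X) f 2) :
    Hcomap 2 f (Hcomap 2 ContinuousMap.snd u - Hcomap 2 ContinuousMap.fst u) = 0 := by
  obtain ⟨c, hc, hcu⟩ := exists_cocycle_representative 1 u
  obtain ⟨U, hU, hcov, hs⟩ := hf
  obtain ⟨s, hs0⟩ := hs 0
  obtain ⟨t, ht1⟩ := hs 1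
  rw [Hcomap_zeroDivisor_eq_zero_iff, Hcomap_eq_iff hcu]
  intro z hz
  have hcov' : U 0 ∪ U 1 = Set.univ := by
    rw [← hcov]; ext y; simp [Fin.exists_fin_two]
  set c' : C(TopSimplex 2, X) → ℚ := fun τ => c (Finsupp.single τ 1) with hc'
  have hcoc : IsCocycle₂ c' := isCocycle₂_of_linear hc
  obtain ⟨α, hα⟩ := exists_small_primitive hcoc (squareEval_eq_zero_of_atoroidal hu hcu)
    (ContinuousMap.fst.comp f) (ContinuousMap.snd.comp f) s.uncurry t.uncurry
    (fun y => congrArg Prod.fst (hs0 y)) (fun y => congrArg Prod.snd (hs0 y))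
    (fun y => congrArg Prod.fst (ht1 y)) (fun y => congrArg Prod.snd (ht1 y))
  have hω : IsCocycle₂ fun τ : C(TopSimplex 2, Y) =>
      c' ((ContinuousMap.snd.comp f).comp τ) - c' ((ContinuousMap.fst.comp f).comp τ) := by
    intro τ
    have h1 := hcoc.comp (ContinuousMap.snd.comp f) τ
    have h2 := hcoc.comp (ContinuousMap.fst.comp f) τ
    linarith
  have h := hω.eq_zero_of_small_primitive (hU 0) (hU 1) hcov' hα z hz
  have key : cochainExt (fun τ : C(TopSimplex 2, Y) =>
      c' ((ContinuousMap.snd.comp f).comp τ) - c' ((ContinuousMap.fst.comp f).comp τ)) =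
      c.comp (chainPush 2 (ContinuousMap.snd.comp f)) -
        c.comp (chainPush 2 (ContinuousMap.fst.comp f)) := by
    refine Finsupp.lhom_ext fun τ a => ?_
    have hs (g : C(TopSimplex 2, X)) : Finsupp.single g a = a • Finsupp.single g (1 : ℚ) := by simp
    rw [LinearMap.sub_apply, LinearMap.comp_apply, LinearMap.comp_apply, chainPush_single,
      chainPush_single, hs, hs, map_smul, map_smul, Finsupp.linearCombination_single, smul_sub]
  rw [key] at h
  exact sub_eq_zero.1 h

end

lemma eq_of_comp_halfMap {K X : Type} [TopologicalSpace K] [TopologicalSpace X]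
    {F F' : C(K × I, X)}
    (h : F.comp ((ContinuousMap.id K).prodMap halfMap) =
      F'.comp ((ContinuousMap.id K).prodMap halfMap))
    (h' : F.comp ((ContinuousMap.id K).prodMap coHalfMap) =
      F'.comp ((ContinuousMap.id K).prodMap coHalfMap)) : F = F' := by
  ext ⟨s, t⟩
  rcases le_total (t : ℝ) (1 / 2) with ht | ht
  · have := DFunLike.congr_fun h (s, ⟨2 * t, by constructor <;> linarith [t.2.1]⟩)
    simpa [halfMap] using this
  · have := DFunLike.congr_fun h' (s, ⟨2 - 2 * t, by constructor <;> linarith [t.2.2]⟩)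
    simpa [coHalfMap, sub_div] using this

section

variable {X : Type} [TopologicalSpace X]

/-- A chosen point in each path component. -/
def compBase (d : ZerothHomotopy X) : X := Quotient.out d

/-- The path component of a point. -/
def compOf (x : X) : ZerothHomotopy X := Quotient.mk (pathSetoid X) x

/-- A chosen path from the chosen point of the component of `x` to `x`. -/
def basePath (x : X) : Path (compBase (compOf x)) x :=
  (show Joined (compBase (compOf x)) x from Quotient.mk_out (s := pathSetoid X) x).somePath

/-- The straight contraction of a simplex to one of its points. -/
def simplexContraction {n : ℕ} (b : TopSimplex n) : C(TopSimplex n × I, TopSimplex n) where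
  toFun x := ⟨(1 - (x.2 : ℝ)) • x.1.val + (x.2 : ℝ) • b.val,
    (convex_stdSimplex ℝ _) x.1.2 b.2 (sub_nonneg.2 x.2.2.2) x.2.2.1 (by ring)⟩
  continuous_toFun := by fun_prop

lemma simplexContraction_zero {n : ℕ} (b y : TopSimplex n) :
    simplexContraction b (y, 0) = y := by
  apply Subtype.ext; simp [simplexContraction]

lemma simplexContraction_one {n : ℕ} (b y : TopSimplex n) :
    simplexContraction b (y, 1) = b := by
  apply Subtype.ext; simp [simplexContraction]

lemma simplexContraction_face {n : ℕ} (j : Fin (n + 2)) (b y : TopSimplex n) (t : I) :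
    faceInclusion n j (simplexContraction b (y, t)) =
      simplexContraction (faceInclusion n j b) (faceInclusion n j y, t) := by
  apply Subtype.ext
  change FunOnFinite.linearMap ℝ ℝ _ ((1 - (t : ℝ)) • y.val + (t : ℝ) • b.val) = _
  rw [map_add, map_smul, map_smul]
  rfl

/-- The homotopy consisting of paths from the chosen point of the component, through the image
of `b`, to the points of a singular simplex. -/
lemma exists_coneHomotopy {n : ℕ} (τ : C(TopSimplex n, X)) (b : TopSimplex n) :
    ∃ F : C(TopSimplex n × I, X),
      F.comp ((ContinuousMap.id _).prodMap halfMap) =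
        (basePath (τ b) : C(I, X)).comp ContinuousMap.snd ∧
      F.comp ((ContinuousMap.id _).prodMap coHalfMap) = τ.comp (simplexContraction b) :=
  exists_glue _ _ fun y => by simp [simplexContraction_one]

/-- A choice of the homotopy of `exists_coneHomotopy`, as a map to the path space. -/
def conePath {n : ℕ} (τ : C(TopSimplex n, X)) (b : TopSimplex n) : C(TopSimplex n, C(I, X)) :=
  (exists_coneHomotopy τ b).choose.curry

lemma compOf_eq {n : ℕ} (τ : C(TopSimplex n, X)) (x y : TopSimplex n) :
    compOf (τ x) = compOf (τ y) :=
  Quotient.sound ⟨⟨τ.comp ((simplexContraction y).comp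
    ((ContinuousMap.const _ x).prodMk (ContinuousMap.id I))),
    by simp [simplexContraction_zero], by simp [simplexContraction_one]⟩⟩

lemma conePath_zero {n : ℕ} (τ : C(TopSimplex n, X)) (b y : TopSimplex n) :
    conePath τ b y 0 = compBase (compOf (τ y)) := by
  have h := DFunLike.congr_fun (exists_coneHomotopy τ b).choose_spec.1 (y, 0)
  have e : halfMap 0 = 0 := by ext; simp [halfMap]
  rw [compOf_eq τ y b]
  simpa [e, conePath] using h

lemma conePath_one {n : ℕ} (τ : C(TopSimplex n, X)) (b y : TopSimplex n) :
    conePath τ b y 1 = τ y := by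
  have h := DFunLike.congr_fun (exists_coneHomotopy τ b).choose_spec.2 (y, 0)
  have e : coHalfMap 0 = 1 := by ext; simp [coHalfMap]
  simpa [e, simplexContraction_zero, conePath] using h

lemma conePath_face {n : ℕ} (τ : C(TopSimplex (n + 1), X)) (j : Fin (n + 2))
    (b y : TopSimplex n) :
    conePath (τ.comp (faceInclusion n j)) b y =
      conePath τ (faceInclusion n j b) (faceInclusion n j y) := by
  have h := (exists_coneHomotopy (τ.comp (faceInclusion n j)) b).choose_spec
  have h' := (exists_coneHomotopy τ (faceInclusion n j b)).choose_spec
  have key : (exists_coneHomotopy (τ.comp (faceInclusion n j)) b).choose =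
      (exists_coneHomotopy τ (faceInclusion n j b)).choose.comp
        ((faceInclusion n j).prodMap (ContinuousMap.id I)) := by
    apply eq_of_comp_halfMap
    · rw [h.1]
      ext x
      exact (DFunLike.congr_fun h'.1 (faceInclusion n j x.1, x.2)).symm
    · rw [h.2]
      ext x
      refine Eq.trans ?_ (DFunLike.congr_fun h'.2 (faceInclusion n j x.1, x.2)).symm
      exact congrArg τ (simplexContraction_face j b x.1 x.2)
  ext t
  exact DFunLike.congr_fun key (y, t)

end

/-- The coordinates of `y` in `S` are positive and larger than those outside of `S`. -/
def Dominates {n : ℕ} (S : Finset (Fin (n + 1))) (y : TopSimplex n) : Prop :=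
  (∀ a ∈ S, 0 < y a) ∧ ∀ a ∈ S, ∀ b ∉ S, y b < y a

/-- The point `b` is the barycentre of the face spanned by `S`. -/
def IsFaceBarycenter {n : ℕ} (S : Finset (Fin (n + 1))) (b : TopSimplex n) : Prop :=
  ∀ a, b a = if a ∈ S then (S.card : ℝ)⁻¹ else 0

lemma exists_isFaceBarycenter {n : ℕ} {S : Finset (Fin (n + 1))} (hS : S.Nonempty) :
    ∃ b, IsFaceBarycenter S b := by
  refine ⟨⟨fun a => if a ∈ S then (S.card : ℝ)⁻¹ else 0, fun a => ?_, ?_⟩, fun a => rfl⟩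
  · dsimp only; split_ifs <;> positivity
  · have : (S.card : ℝ) ≠ 0 := by exact_mod_cast hS.card_ne_zero
    simp [this]

lemma IsFaceBarycenter.eq {n : ℕ} {S : Finset (Fin (n + 1))} {b b' : TopSimplex n}
    (h : IsFaceBarycenter S b) (h' : IsFaceBarycenter S b') : b = b' := by
  ext a; rw [h a, h' a]

lemma Dominates.eq {n : ℕ} {S S' : Finset (Fin (n + 1))} {y : TopSimplex n}
    (h : Dominates S y) (h' : Dominates S' y) (hc : S.card = S'.card) : S = S' := by
  by_contra hne
  obtain ⟨a, ha, ha'⟩ : ∃ a ∈ S, a ∉ S' := by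
    by_contra! H
    exact hne (Finset.eq_of_subset_of_card_le H hc.ge)
  obtain ⟨b, hb, hb'⟩ : ∃ b ∈ S', b ∉ S := by
    by_contra! H
    exact hne (Finset.eq_of_subset_of_card_le H hc.le).symm
  exact lt_asymm (h.2 a ha b hb') (h'.2 b hb a ha')

lemma isOpen_dominates {n : ℕ} (S : Finset (Fin (n + 1))) :
    IsOpen {y : TopSimplex n | Dominates S y} := by
  have hcont (a : Fin (n + 1)) : Continuous fun y : TopSimplex n => y a :=
    (continuous_apply a).comp continuous_subtype_val
  simp only [Dominates, Set.ofPred_and, Set.ofPred_forall]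
  refine IsOpen.inter ?_ ?_
  · exact isOpen_iInter_of_finite fun a => isOpen_iInter_of_finite fun _ =>
      isOpen_lt continuous_const (hcont a)
  · exact isOpen_iInter_of_finite fun a => isOpen_iInter_of_finite fun _ =>
      isOpen_iInter_of_finite fun b => isOpen_iInter_of_finite fun _ =>
        isOpen_lt (hcont b) (hcont a)

lemma exists_dominates {n : ℕ} (y : TopSimplex n) :
    ∃ S : Finset (Fin (n + 1)), S.Nonempty ∧ Dominates S y := by
  classical
  obtain ⟨a, -, ha⟩ := Finset.exists_max_image Finset.univ (fun a => y a) Finset.univ_nonempty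
  have hpos : 0 < y a := by
    by_contra! H
    have h1 : ∑ i, y i ≤ 0 := Finset.sum_nonpos fun i hi => (ha i hi).trans H
    have h2 : ∑ i, y i = 1 := y.2.2
    linarith
  refine ⟨Finset.univ.filter fun b => y b = y a, ⟨a, by simp⟩, ?_, ?_⟩
  · intro b hb
    rw [(Finset.mem_filter.1 hb).2]
    exact hpos
  · intro b hb d hd
    rw [(Finset.mem_filter.1 hb).2]
    refine lt_of_le_of_ne (ha d (Finset.mem_univ _)) fun h => hd ?_
    simp [h]

lemma faceInclusion_succAbove {n : ℕ} (j : Fin (n + 2)) (y : TopSimplex n) (a : Fin (n + 1)) :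
    faceInclusion n j y (j.succAbove a) = y a := by
  change stdSimplex.map j.succAbove y (j.succAbove a) = y a
  rw [stdSimplex_map_apply]
  simp

lemma faceInclusion_self {n : ℕ} (j : Fin (n + 2)) (y : TopSimplex n) :
    faceInclusion n j y j = 0 := by
  change stdSimplex.map j.succAbove y j = 0
  rw [stdSimplex_map_apply]
  simp [Fin.succAbove_ne]

lemma dominates_face_iff {n : ℕ} (j : Fin (n + 2)) (y : TopSimplex n)
    (S : Finset (Fin (n + 1))) :
    Dominates (S.map j.succAboveEmb) (faceInclusion n j y) ↔ Dominates S y := by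
  simp only [Dominates, Finset.forall_mem_map, Fin.succAboveEmb_apply, faceInclusion_succAbove]
  refine and_congr_right fun hpos => forall₂_congr fun a ha => ⟨fun h b hb => ?_, fun h b hb => ?_⟩
  · have := h (j.succAbove b) (by simpa using hb)
    rwa [faceInclusion_succAbove] at this
  · rcases Fin.eq_self_or_eq_succAbove j b with rfl | ⟨b, rfl⟩
    · rw [faceInclusion_self]; exact hpos a ha
    · rw [faceInclusion_succAbove]
      exact h b (by simpa using hb)

lemma Dominates.exists_eq_map {n : ℕ} {j : Fin (n + 2)} {y : TopSimplex n}
    {S : Finset (Fin (n + 2))} (h : Dominates S (faceInclusion n j y)) :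
    ∃ S' : Finset (Fin (n + 1)), S = S'.map j.succAboveEmb := by
  classical
  refine ⟨Finset.univ.filter fun a => j.succAbove a ∈ S, ?_⟩
  ext b
  rcases Fin.eq_self_or_eq_succAbove j b with rfl | ⟨b, rfl⟩
  · have : b ∉ S := fun hb => by
      have := h.1 b hb
      rw [faceInclusion_self] at this
      exact lt_irrefl _ this
    simp [this, Fin.succAbove_ne]
  · simp

lemma IsFaceBarycenter.face {n : ℕ} {S : Finset (Fin (n + 1))} {b : TopSimplex n}
    (h : IsFaceBarycenter S b) (j : Fin (n + 2)) :
    IsFaceBarycenter (S.map j.succAboveEmb) (faceInclusion n j b) := by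
  intro a
  rcases Fin.eq_self_or_eq_succAbove j a with rfl | ⟨a, rfl⟩
  · rw [faceInclusion_self]
    simp [Fin.succAbove_ne]
  · rw [faceInclusion_succAbove, h a]
    simp

/-- A point `pt` of `X`, together with at most one path from the chosen point of a path component
to `pt` for every index `i : Fin m`, and at least one such path altogether. -/
@[ext]
structure PathJoin (X : Type) [TopologicalSpace X] (m : ℕ) where
  comp : ZerothHomotopy X
  pt : X
  paths : Fin m → Set C(I, X)
  subsingleton : ∀ i, (paths i).Subsingleton
  nonempty : ∃ i, (paths i).Nonempty
  ends : ∀ i, ∀ g ∈ paths i, g 0 = compBase comp ∧ g 1 = pt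

namespace PathJoin

variable {X : Type} [TopologicalSpace X] {m : ℕ}

/-- The coarsest topology for which the component is locally constant, the point is continuous,
and the paths are continuous on open sets. -/
instance : TopologicalSpace (PathJoin X m) :=
  TopologicalSpace.generateFrom ({A | ∃ D : Set (ZerothHomotopy X), A = {y | y.comp ∈ D}} ∪
    {A | ∃ W : Set X, IsOpen W ∧ A = {y | y.pt ∈ W}} ∪
    {A | ∃ (i : Fin m) (W : Set C(I, X)), IsOpen W ∧ A = {y | (y.paths i ∩ W).Nonempty}})

lemma isOpen_comp (D : Set (ZerothHomotopy X)) : IsOpen {y : PathJoin X m | y.comp ∈ D} :=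
  .basic _ (Or.inl (Or.inl ⟨D, rfl⟩))

lemma isOpen_pt {W : Set X} (hW : IsOpen W) : IsOpen {y : PathJoin X m | y.pt ∈ W} :=
  .basic _ (Or.inl (Or.inr ⟨W, hW, rfl⟩))

lemma isOpen_paths (i : Fin m) {W : Set C(I, X)} (hW : IsOpen W) :
    IsOpen {y : PathJoin X m | (y.paths i ∩ W).Nonempty} :=
  .basic _ (Or.inr ⟨i, W, hW, rfl⟩)

/-- The projection to the endpoint. -/
def endPt : C(PathJoin X m, X) := ⟨pt, ⟨fun _ hW => isOpen_pt hW⟩⟩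

/-- The projection to the chosen point of the component. -/
def startPt : C(PathJoin X m, X) :=
  ⟨fun y => compBase y.comp, ⟨fun W _ => isOpen_comp (compBase ⁻¹' W)⟩⟩

lemma genusPullbackLE :
    GenusPullbackLE (pathFibration X) ((startPt (X := X) (m := m)).prodMk endPt) m := by
  refine ⟨fun i => {y | (y.paths i ∩ Set.univ).Nonempty}, fun i => isOpen_paths i isOpen_univ,
    ?_, fun i => ?_⟩
  · refine Set.eq_univ_of_forall fun y => Set.mem_iUnion.2 ?_
    obtain ⟨i, hi⟩ := y.nonempty
    exact ⟨i, by simpa using hi⟩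
  · let s (y : {y : PathJoin X m | (y.paths i ∩ Set.univ).Nonempty}) : C(I, X) := y.2.choose
    have hs (y) : s y ∈ y.1.paths i := y.2.choose_spec.1
    refine ⟨⟨s, ⟨fun W hW => ?_⟩⟩, fun y => ?_⟩
    · convert (isOpen_paths i hW).preimage continuous_subtype_val using 1
      ext y
      refine ⟨fun h => ⟨s y, hs y, h⟩, ?_⟩
      rintro ⟨g, hg, hgW⟩
      rw [Set.mem_preimage, y.1.subsingleton i (hs y) hg]
      exact hgW
    · exact Prod.ext (y.1.ends i _ (hs y)).1 (y.1.ends i _ (hs y)).2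

variable {n : ℕ}

/-- The canonical lift of a singular simplex of small dimension. -/
def lift (hn : n < m) (τ : C(TopSimplex n, X)) : C(TopSimplex n, PathJoin X m) where
  toFun y :=
    { comp := compOf (τ y)
      pt := τ y
      paths := fun i => {g | ∃ S b, S.card = (i : ℕ) + 1 ∧ Dominates S y ∧ IsFaceBarycenter S b ∧
        g = conePath τ b y}
      subsingleton := by
        rintro i _ ⟨S, b, hS, hy, hb, rfl⟩ _ ⟨S', b', hS', hy', hb', rfl⟩
        obtain rfl := hy.eq hy' (hS.trans hS'.symm)
        rw [hb.eq hb']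
      nonempty := by
        obtain ⟨S, hS, hy⟩ := exists_dominates y
        obtain ⟨b, hb⟩ := exists_isFaceBarycenter hS
        have h1 := hS.card_pos
        have h2 := card_finset_fin_le S
        exact ⟨⟨S.card - 1, by omega⟩, conePath τ b y, S, b, by simp; omega, hy, hb, rfl⟩
      ends := by
        rintro i _ ⟨S, b, -, -, -, rfl⟩
        exact ⟨conePath_zero τ b y, conePath_one τ b y⟩ }
  continuous_toFun := by
    refine continuous_generateFrom_iff.2 ?_
    rintro _ ((⟨D, rfl⟩ | ⟨W, hW, rfl⟩) | ⟨i, W, hW, rfl⟩)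
    · by_cases h : compOf (τ (stdSimplex.vertex 0)) ∈ D
      · convert isOpen_univ
        refine Set.eq_univ_of_forall fun y => ?_
        change compOf (τ y) ∈ D
        rwa [compOf_eq τ y (stdSimplex.vertex 0)]
      · convert isOpen_empty
        refine Set.eq_empty_of_forall_notMem fun y hy => h ?_
        change compOf (τ y) ∈ D at hy
        rwa [compOf_eq τ y (stdSimplex.vertex 0)] at hy
    · exact hW.preimage τ.continuous
    · have : IsOpen (⋃ (S : Finset (Fin (n + 1))) (b : TopSimplex n)
          (_ : S.card = (i : ℕ) + 1 ∧ IsFaceBarycenter S b),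
          {y | Dominates S y} ∩ conePath τ b ⁻¹' W) :=
        isOpen_iUnion fun S => isOpen_iUnion fun b => isOpen_iUnion fun _ =>
          (isOpen_dominates S).inter (hW.preimage (conePath τ b).continuous)
      convert this using 1
      ext y
      simp only [Set.mem_iUnion]
      constructor
      · rintro ⟨_, ⟨S, b, hS, hy, hb, rfl⟩, hg⟩
        exact ⟨S, b, ⟨hS, hb⟩, hy, hg⟩
      · rintro ⟨S, b, ⟨hS, hb⟩, hy, hg⟩
        exact ⟨_, ⟨S, b, hS, hy, hb, rfl⟩, hg⟩

lemma lift_face (hn : n + 1 < m) (τ : C(TopSimplex (n + 1), X)) (j : Fin (n + 2)) :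
    (lift hn τ).comp (faceInclusion n j) =
      lift (Nat.lt_of_succ_lt hn) (τ.comp (faceInclusion n j)) := by
  ext1 y
  refine PathJoin.ext rfl rfl (funext fun i => Set.ext fun g => ⟨?_, ?_⟩)
  · rintro ⟨S, b, hS, hy, hb, rfl⟩
    obtain ⟨S, rfl⟩ := hy.exists_eq_map
    rw [Finset.card_map] at hS
    obtain ⟨b', hb'⟩ := exists_isFaceBarycenter (S := S) (Finset.card_pos.1 (by omega))
    obtain rfl := hb.eq (hb'.face j)
    exact ⟨S, b', hS, (dominates_face_iff j y S).1 hy, hb', (conePath_face τ j b' y).symm⟩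
  · rintro ⟨S, b, hS, hy, hb, rfl⟩
    exact ⟨S.map j.succAboveEmb, faceInclusion n j b, by rwa [Finset.card_map],
      (dominates_face_iff j y S).2 hy, hb.face j, conePath_face τ j b y⟩

/-- The canonical lift of singular chains. -/
def liftChain (hn : n < m) : SingChain n X →ₗ[ℚ] SingChain n (PathJoin X m) :=
  Finsupp.lmapDomain ℚ ℚ (lift hn)

lemma singBoundary_liftChain (hn : n + 1 < m) (z : SingChain (n + 1) X) :
    singBoundary n (liftChain hn z) = liftChain (Nat.lt_of_succ_lt hn) (singBoundary n z) := by
  induction z using Finsupp.induction_linear with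
  | zero => simp
  | add x y hx hy => simp only [map_add, hx, hy]
  | single τ a =>
    simp only [liftChain, Finsupp.lmapDomain_apply, Finsupp.mapDomain_single, singBoundary_single,
      lift_face]
    rw [Finsupp.mapDomain_smul, Finsupp.mapDomain_finsetSum]
    simp only [Finsupp.mapDomain_smul, Finsupp.mapDomain_single]

lemma chainPush_endPt_liftChain (hn : n < m) (z : SingChain n X) :
    chainPush n endPt (liftChain hn z) = z := by
  induction z using Finsupp.induction_linear with
  | zero => simp
  | add x y hx hy => simp only [map_add, hx, hy]
  | single τ a =>
    simp only [liftChain, Finsupp.lmapDomain_apply, Finsupp.mapDomain_single, chainPush_single]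
    rfl

/-- Cycles of dimension two which are supported on constant simplices vanish. -/
lemma mapDomain_const_eq_zero (w : X →₀ ℚ)
    (h : singBoundary 1 (w.mapDomain (ContinuousMap.const (TopSimplex 2))) = 0) :
    w = 0 := by
  have key (w : X →₀ ℚ) : singBoundary 1 (w.mapDomain (ContinuousMap.const (TopSimplex 2))) =
      w.mapDomain (ContinuousMap.const (TopSimplex 1)) := by
    induction w using Finsupp.induction_linear with
    | zero => simp
    | add x y hx hy => simp only [Finsupp.mapDomain_add, map_add, hx, hy]
    | single x a =>
      simp only [Finsupp.mapDomain_single, singBoundary_single, ContinuousMap.const_comp]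
      simp [Fin.sum_univ_three]
  rw [key] at h
  refine Finsupp.mapDomain_injective (fun x y hxy => ?_) (h.trans Finsupp.mapDomain_zero.symm)
  exact DFunLike.congr_fun hxy (stdSimplex.vertex 0)

lemma chainPush_startPt_liftChain (hn : 2 < m) (z : SingChain 2 X)
    (hz : singBoundary 1 z = 0) : chainPush 2 startPt (liftChain hn z) = 0 := by
  have key (z : SingChain 2 X) : chainPush 2 startPt (liftChain hn z) =
      (z.mapDomain fun τ => compBase (compOf (τ (stdSimplex.vertex 0)))).mapDomain
        (ContinuousMap.const (TopSimplex 2)) := by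
    induction z using Finsupp.induction_linear with
    | zero => simp
    | add x y hx hy => simp only [Finsupp.mapDomain_add, map_add, hx, hy]
    | single τ a =>
      simp only [liftChain, Finsupp.lmapDomain_apply, Finsupp.mapDomain_single, chainPush_single]
      congr 1
      ext y
      exact congrArg compBase (compOf_eq τ _ _)
  have h : singBoundary 1 (chainPush 2 startPt (liftChain hn z)) = 0 := by
    rw [← chainPush_singBoundary, singBoundary_liftChain, hz, map_zero, map_zero]
  rw [key] at h ⊢
  rw [mapDomain_const_eq_zero _ h, Finsupp.mapDomain_zero]

end PathJoin

section

variable {X : Type} [TopologicalSpace X]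

/-- The zero divisor of a non-zero class is detected on a space of any genus above two. -/
theorem Hcomap_zeroDivisor_pathJoin_ne_zero {u : Hco 2 X} (hu : u ≠ 0) {m : ℕ} (hm : 2 < m) :
    Hcomap 2 ((PathJoin.startPt (X := X) (m := m)).prodMk PathJoin.endPt)
      (Hcomap 2 ContinuousMap.snd u - Hcomap 2 ContinuousMap.fst u) ≠ 0 := by
  obtain ⟨c, hc, hcu⟩ := exists_cocycle_representative 1 u
  intro h
  rw [Hcomap_zeroDivisor_eq_zero_iff, Hcomap_eq_iff hcu] at h
  refine hu (LinearMap.ext fun x => ?_)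
  obtain ⟨⟨z, hz⟩, rfl⟩ := cycleClass_surjective 1 x
  rw [LinearMap.mem_ker] at hz
  have h' := h (PathJoin.liftChain hm z) (by
    rw [PathJoin.singBoundary_liftChain, hz, map_zero])
  change c (chainPush 2 PathJoin.endPt _) = c (chainPush 2 PathJoin.startPt _) at h'
  rw [PathJoin.chainPush_endPt_liftChain, PathJoin.chainPush_startPt_liftChain hm z hz,
    map_zero] at h'
  rw [← hcu ⟨z, hz⟩, LinearMap.zero_apply]
  exact h'

end

/-- **Proposition.**  If `u ∈ H²(X; ℚ)` is an atoroidal class, then the topological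
complexity weight of the zero divisor `ū = 1 × u − u × 1 = pr₂*(u) − pr₁*(u)` in
`H²(X × X; ℚ)` equals `2`. -/
theorem tcWeight_of_atoroidal_eq_two
    (X : Type) [TopologicalSpace X] (u : Hco 2 X) (hu : IsCoAtoroidal u) :
    tcWeight
      (Hcomap 2 (ContinuousMap.snd (α := X) (β := X)) u -
        Hcomap 2 (ContinuousMap.fst (α := X) (β := X)) u) = 2 := by
  apply le_antisymm
  · refine sSup_le ?_
    rintro _ ⟨m, rfl, hm⟩
    by_contra! h
    have h2 : 2 < m := by exact_mod_cast h
    exact Hcomap_zeroDivisor_pathJoin_ne_zero hu.1 h2 (hm _ _ PathJoin.genusPullbackLE)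
  · exact le_sSup ⟨2, rfl, fun Y _ f hf => Hcomap_zeroDivisor_eq_zero hu.2 f hf⟩

end
end
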